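/- arXiv:math/0404192 — 2 statements merged into one kernel-verified Lean document; each statement's English description precedes it below -/
import Mathlib

section
/- Let X be a Banach space and let T : ℓ₂^n → X be a linear operator with ℓ(T) ≥ √n. Let α = c·(log(2‖T‖))^{−3/2}. Then there exists a subset σ of {1,…,n} with |σ| ≥ c·α²·n/‖T‖² such that ‖Tx‖ ≥ α·|σ|^{−1/2}·‖x‖_{ℓ₁^σ} for all x ∈ ℝ^σ, where c > 0 is an absolute constant and ‖x‖_{ℓ₁^σ} = Σ_{i∈σ} |x(i)|. -/
open MeasureTheory
open scoped ENNReal NNReal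

/-- The law of `n` i.i.d. standard Gaussian random variables. -/
noncomputable def gaussPi (n : ℕ) : Measure (Fin n → ℝ) :=
  Measure.pi fun _ => ProbabilityTheory.gaussianReal 0 1

/-- The square of the `ℓ`-norm of an operator `T : ℓ₂^n → X`: `ℓ(T)² = 𝔼‖Tg‖²` for a
standard Gaussian vector `g`. -/
noncomputable def ellNormSq {X : Type*} [NormedAddCommGroup X] [NormedSpace ℝ X]
    {n : ℕ} (T : EuclideanSpace ℝ (Fin n) →L[ℝ] X) : ℝ :=
  ∫ g : Fin n → ℝ, ‖T ((WithLp.equiv 2 (Fin n → ℝ)).symm g)‖ ^ 2 ∂(gaussPi n)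

def Shat {n : ℕ} (h : ℝ) (A : Finset (EuclideanSpace ℝ (Fin n))) (p : Fin n → Option ℤ) : Prop :=
  ∀ e : Fin n → Bool, ∃ f ∈ A, ∀ i b, p i = some b →
    (e i = true → ((b : ℝ) + 1) * h ≤ f i) ∧ (e i = false → f i ≤ (b : ℝ) * h)

lemma Shat.mono {n : ℕ} {h : ℝ} {A B : Finset (EuclideanSpace ℝ (Fin n))} {p : Fin n → Option ℤ}
    (hAB : A ⊆ B) (hp : Shat h A p) : Shat h B p := by
  intro e
  obtain ⟨f, hf, H⟩ := hp e
  exact ⟨f, hAB hf, H⟩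

open Classical in
lemma shat_split {n : ℕ} {h : ℝ} (hh : 0 < h) {A P N : Finset (EuclideanSpace ℝ (Fin n))}
    (hP : P ⊆ A) (hN : N ⊆ A) (i : Fin n) (b : ℤ)
    (hPb : ∀ f ∈ P, ((b : ℝ) + 1) * h ≤ f i) (hNb : ∀ f ∈ N, f i ≤ (b : ℝ) * h)
    (U : Finset (Fin n → Option ℤ)) (hU : ∀ p, Shat h A p → p ∈ U) :
    (U.filter (Shat h P)).card + (U.filter (Shat h N)).card ≤ (U.filter (Shat h A)).card := by
  have keyP : ∀ p, Shat h P p → ∀ b', p i = some b' → b + 1 ≤ b' := by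
    intro p hp b' hb'
    obtain ⟨f, hf, H⟩ := hp (fun _ => false)
    have h1 := (H i b' hb').2 rfl
    have h2 := hPb f hf
    have : ((b : ℝ) + 1) ≤ b' := le_of_mul_le_mul_right (h2.trans h1) hh
    exact_mod_cast this
  have keyN : ∀ p, Shat h N p → ∀ b', p i = some b' → b' + 1 ≤ b := by
    intro p hp b' hb'
    obtain ⟨f, hf, H⟩ := hp (fun _ => true)
    have h1 := (H i b' hb').1 rfl
    have h2 := hNb f hf
    have : ((b' : ℝ) + 1) ≤ b := le_of_mul_le_mul_right (h1.trans h2) hh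
    exact_mod_cast this
  set SP := U.filter (Shat h P)
  set SN := U.filter (Shat h N)
  rw [← Finset.card_union_add_card_inter]
  have hnone : ∀ p ∈ SP ∩ SN, p i = none := by
    intro p hp
    rw [Finset.mem_inter, Finset.mem_filter, Finset.mem_filter] at hp
    by_contra hne
    obtain ⟨b', hb'⟩ := Option.ne_none_iff_exists'.1 hne
    have := keyP p hp.1.2 b' hb'
    have := keyN p hp.2.2 b' hb'
    omega
  have hinj : Set.InjOn (fun p : Fin n → Option ℤ => Function.update p i (some b)) (SP ∩ SN : Finset _) := by
    intro p hp q hq hpq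
    have h1 := hnone p hp
    have h2 := hnone q hq
    funext j
    by_cases hj : j = i
    · rw [hj, h1, h2]
    · have := congrFun hpq j
      simpa [Function.update_of_ne hj] using this
  rw [← Finset.card_image_of_injOn hinj, ← Finset.card_union_of_disjoint]
  · apply Finset.card_le_card
    intro p hp
    have hs : Shat h A p := by
      rw [Finset.mem_union, Finset.mem_union, Finset.mem_image] at hp
      rcases hp with (hp | hp) | ⟨q, hq, rfl⟩
      · exact (Finset.mem_filter.1 hp).2.mono hP
      · exact (Finset.mem_filter.1 hp).2.mono hN
      · have hqn := hnone q hq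
        rw [Finset.mem_inter, Finset.mem_filter, Finset.mem_filter] at hq
        intro e
        cases he : e i
        · obtain ⟨f, hf, H⟩ := hq.2.2 e
          refine ⟨f, hN hf, fun j b' hb' => ?_⟩
          by_cases hj : j = i
          · subst hj
            simp at hb'
            subst hb'
            simp [he, hNb f hf]
          · rw [Function.update_of_ne hj] at hb'
            exact H j b' hb'
        · obtain ⟨f, hf, H⟩ := hq.1.2 e
          refine ⟨f, hP hf, fun j b' hb' => ?_⟩
          by_cases hj : j = i
          · subst hj
            simp at hb'
            subst hb'
            simp [he, hPb f hf]
          · rw [Function.update_of_ne hj] at hb'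
            exact H j b' hb'
    exact Finset.mem_filter.2 ⟨hU p hs, hs⟩
  · rw [Finset.disjoint_left]
    intro p hp hp2
    obtain ⟨q, hq, rfl⟩ := Finset.mem_image.1 hp2
    rw [Finset.mem_union] at hp
    rcases hp with hp | hp
    · have := keyP _ (Finset.mem_filter.1 hp).2 b (by simp)
      omega
    · have := keyN _ (Finset.mem_filter.1 hp).2 b (by simp)
      omega

/-- one-sided tail bound -/
lemma tail_half {ι : Type*} (A : Finset ι) (X : ι → ℝ) (d m : ℝ) (hd : 0 < d)
    (hm : (2 : ℝ) * (A.filter (fun f => m < X f)).card ≤ A.card)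
    (H : ∀ a, (A.filter (fun f => a + d ≤ X f)).Nonempty → (A.filter (fun f => X f ≤ a)).Nonempty →
      √((A.filter (fun f => a + d ≤ X f)).card : ℝ) + √((A.filter (fun f => X f ≤ a)).card : ℝ)
      < √(A.card : ℝ)) (k : ℕ) :
    (2 : ℝ) ^ (k + 1) * (A.filter (fun f => m + k * d < X f)).card ≤ A.card := by
  induction k with
  | zero => simpa using hm
  | succ k ih =>
    set N : ℝ := (A.card : ℝ)
    set p : ℝ := ((A.filter (fun f => m + k * d < X f)).card : ℝ)
    set q : ℝ := ((A.filter (fun f => m + k * d + d ≤ X f)).card : ℝ)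
    have hq : ((A.filter (fun f => m + (k + 1 : ℕ) * d < X f)).card : ℝ) ≤ q := by
      apply Nat.cast_le.2
      apply Finset.card_le_card
      apply Finset.monotone_filter_right
      intro f _ hf
      push_cast at hf
      linarith
    have hp : ((A.filter (fun f => X f ≤ m + k * d)).card : ℝ) = N - p := by
      have := Finset.card_filter_add_card_filter_not (s := A) (fun f => X f ≤ m + k * d)
      simp only [not_le] at this
      have h2 : ((A.filter (fun f => X f ≤ m + k * d)).card : ℝ) + p = N := by
        have t := congrArg (Nat.cast : ℕ → ℝ) this
        rwa [Nat.cast_add] at t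
      linarith
    have hp0 : 0 ≤ p := Nat.cast_nonneg _
    have hq0 : 0 ≤ q := Nat.cast_nonneg _
    have hpN : 2 * p ≤ N := by
      have : (1 : ℝ) ≤ 2 ^ k := one_le_pow₀ (by norm_num)
      rw [pow_succ] at ih
      nlinarith
    have h2q : 2 * q ≤ p := by
      rcases (A.filter (fun f => m + k * d + d ≤ X f)).eq_empty_or_nonempty with hPe | hPn
      · have : q = 0 := by simp only [q, hPe]; simp
        linarith
      have hNpos : 0 < N := by
        obtain ⟨f, hf⟩ := hPn
        exact Nat.cast_pos.2 (Finset.card_pos.2 ⟨f, (Finset.mem_filter.1 hf).1⟩)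
      have hNn : (A.filter (fun f => X f ≤ m + k * d)).Nonempty := by
        apply Finset.card_pos.1
        have : (0 : ℝ) < ((A.filter (fun f => X f ≤ m + k * d)).card : ℝ) := by rw [hp]; linarith
        exact_mod_cast this
      have hH := H (m + k * d) hPn hNn
      rw [hp] at hH
      change √q + √(N - p) < √N at hH
      have e1 := Real.sq_sqrt hq0
      have e2 := Real.sq_sqrt (show 0 ≤ N - p by linarith)
      have e3 := Real.sq_sqrt (show 0 ≤ N by linarith)
      have n1 := Real.sqrt_nonneg q
      have n2 := Real.sqrt_nonneg (N - p)
      have n3 := Real.sqrt_nonneg N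
      set x := √q
      set y := √(N - p)
      set z := √N
      -- x < z - y, p = z^2 - y^2, 2p ≤ z^2 so y^2 ≥ z^2/2
      have hp' : p = z ^ 2 - y ^ 2 := by linarith
      have hy : z ^ 2 ≤ 2 * y ^ 2 := by linarith
      have hyz : y ≤ z := by linarith
      have h3 : x ^ 2 ≤ (z - y) ^ 2 := by
        apply pow_le_pow_left₀ n1; linarith
      have h4 : 2 * (z - y) ≤ z + y := by
        -- z ≤ 3 y
        nlinarith
      nlinarith
    calc (2 : ℝ) ^ (k + 1 + 1) * ((A.filter (fun f => m + (k + 1 : ℕ) * d < X f)).card : ℝ)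
        ≤ 2 ^ (k + 1 + 1) * q := by gcongr
      _ = 2 ^ (k + 1) * (2 * q) := by ring
      _ ≤ 2 ^ (k + 1) * p := by gcongr
      _ ≤ N := ih

lemma sum_geo (K : ℕ) : ∑ k ∈ Finset.range K, (2 * (k : ℝ) + 1) / 2 ^ (k + 1) ≤ 3 - (2 * K + 3) / 2 ^ K := by
  induction K with
  | zero => norm_num
  | succ K ih =>
    rw [Finset.sum_range_succ]
    have : (3 : ℝ) - (2 * (K + 1 : ℕ) + 3) / 2 ^ (K + 1) = 3 - (2 * K + 3) / 2 ^ K + (2 * K + 1) / 2 ^ (K + 1) := by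
      push_cast
      field_simp
      ring
    rw [this]
    linarith

lemma tail_sum {ι : Type*} (A : Finset ι) (X : ι → ℝ) (d m : ℝ) (hd : 0 < d)
    (hm : (2 : ℝ) * (A.filter (fun f => m < X f)).card ≤ A.card)
    (H : ∀ a, (A.filter (fun f => a + d ≤ X f)).Nonempty → (A.filter (fun f => X f ≤ a)).Nonempty →
      √((A.filter (fun f => a + d ≤ X f)).card : ℝ) + √((A.filter (fun f => X f ≤ a)).card : ℝ)
      < √(A.card : ℝ)) :
    ∑ f ∈ A, (max (X f - m) 0) ^ 2 ≤ 3 * d ^ 2 * A.card := by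
  obtain ⟨K, hK⟩ : ∃ K : ℕ, ∀ f ∈ A, X f - m ≤ K * d := by
    have hbd : ∀ f ∈ A, ∃ K : ℕ, X f - m ≤ K * d := by
      intro f _
      obtain ⟨K, hK⟩ := exists_nat_ge ((X f - m) / d)
      exact ⟨K, by rwa [div_le_iff₀ hd] at hK⟩
    choose! g hg using hbd
    refine ⟨A.sup g, fun f hf => (hg f hf).trans ?_⟩
    gcongr
    exact Finset.le_sup hf
  have hpt : ∀ L : ℕ, ∀ x : ℝ, x ≤ L * d →
      (max x 0) ^ 2 ≤ d ^ 2 * ∑ k ∈ Finset.range L, (2 * (k : ℝ) + 1) * (if k * d < x then 1 else 0) := by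
    intro L x
    induction L with
    | zero => intro hx; simp at hx; simp [hx]
    | succ L ih =>
      intro hx
      rw [Finset.sum_range_succ]
      by_cases hLx : L * d < x
      · have hs : ∑ k ∈ Finset.range L, (2 * (k : ℝ) + 1) * (if k * d < x then 1 else 0) = (L : ℝ) ^ 2 := by
          have : ∀ k ∈ Finset.range L, (2 * (k : ℝ) + 1) * (if k * d < x then 1 else 0) = 2 * (k : ℝ) + 1 := by
            intro k hk
            have hk' : (k : ℝ) ≤ L := by exact_mod_cast (Finset.mem_range.1 hk).le
            rw [if_pos (by nlinarith), mul_one]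
          rw [Finset.sum_congr rfl this]
          clear this ih hx hLx
          induction L with
          | zero => simp
          | succ L ih => rw [Finset.sum_range_succ, ih]; push_cast; ring
        rw [hs, if_pos hLx]
        have hx0 : 0 ≤ x := le_trans (by positivity) hLx.le
        rw [max_eq_left hx0]
        push_cast at hx
        calc x ^ 2 ≤ ((L + 1) * d) ^ 2 := by gcongr
          _ = _ := by ring
      · rw [if_neg hLx, mul_zero, add_zero]
        exact ih (not_lt.1 hLx)
  calc ∑ f ∈ A, (max (X f - m) 0) ^ 2
      ≤ ∑ f ∈ A, d ^ 2 * ∑ k ∈ Finset.range K, (2 * (k : ℝ) + 1) * (if k * d < X f - m then 1 else 0) :=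
        Finset.sum_le_sum fun f hf => hpt K _ (hK f hf)
    _ = d ^ 2 * ∑ k ∈ Finset.range K, (2 * (k : ℝ) + 1) * (A.filter (fun f => m + k * d < X f)).card := by
        rw [← Finset.mul_sum, Finset.sum_comm]
        congr 1
        apply Finset.sum_congr rfl
        intro k _
        rw [← Finset.mul_sum, Finset.sum_boole]
        congr 3
        apply Finset.filter_congr
        intro f _
        rw [lt_sub_iff_add_lt, add_comm]
    _ ≤ d ^ 2 * ∑ k ∈ Finset.range K, ((2 * (k : ℝ) + 1) / 2 ^ (k + 1)) * A.card := by
        refine mul_le_mul_of_nonneg_left (Finset.sum_le_sum fun k hk => ?_) (by positivity)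
        have := tail_half A X d m hd hm H k
        rw [div_mul_eq_mul_div, mul_div_assoc]
        gcongr
        rw [le_div_iff₀ (by positivity)]
        linarith
    _ ≤ d ^ 2 * (3 * A.card) := by
        rw [← Finset.sum_mul]
        gcongr
        refine (sum_geo K).trans ?_
        have : (0 : ℝ) ≤ (2 * K + 3) / 2 ^ K := by positivity
        linarith
    _ = _ := by ring

lemma exists_median {ι : Type*} (A : Finset ι) (hA : A.Nonempty) (X : ι → ℝ) :
    ∃ m, 2 * (A.filter (fun f => m < X f)).card ≤ A.card ∧ 2 * (A.filter (fun f => X f < m)).card ≤ A.card := by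
  set B := A.filter (fun g => 2 * (A.filter (fun f => X g < X f)).card ≤ A.card) with hB
  have hBn : B.Nonempty := by
    obtain ⟨g, hg, hmax⟩ := A.exists_max_image X hA
    refine ⟨g, Finset.mem_filter.2 ⟨hg, ?_⟩⟩
    rw [Finset.filter_false_of_mem]
    · simp
    · intro f hf; exact not_lt.2 (hmax f hf)
  obtain ⟨g, hg, hmin⟩ := B.exists_min_image X hBn
  refine ⟨X g, (Finset.mem_filter.1 hg).2, ?_⟩
  rcases (A.filter (fun f => X f < X g)).eq_empty_or_nonempty with he | hne
  · rw [he]; simp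
  · obtain ⟨u, hu, humax⟩ := Finset.exists_max_image _ X hne
    rw [Finset.mem_filter] at hu
    have hnB : u ∉ B := fun h => absurd (hmin u h) (not_le.2 hu.2)
    have h1 : A.card < 2 * (A.filter (fun f => X u < X f)).card := by
      by_contra h; exact hnB (Finset.mem_filter.2 ⟨hu.1, not_lt.1 h⟩)
    have h2 : (A.filter (fun f => X f < X g)).card ≤ (A.filter (fun f => ¬ X u < X f)).card := by
      apply Finset.card_le_card
      intro f hf
      refine Finset.mem_filter.2 ⟨(Finset.mem_filter.1 hf).1, not_lt.2 (humax f hf)⟩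
    have h3 := Finset.card_filter_add_card_filter_not (s := A) (fun f => X u < X f)
    omega

lemma small_dev {ι : Type*} (A : Finset ι) (X : ι → ℝ) (d : ℝ) (hd : 0 < d)
    (hV : 12 * d ^ 2 * (A.card : ℝ) ^ 2 < ∑ f ∈ A, ∑ g ∈ A, (X f - X g) ^ 2) :
    ∃ a, (A.filter (fun f => a + d ≤ X f)).Nonempty ∧ (A.filter (fun f => X f ≤ a)).Nonempty ∧ √(A.card : ℝ) ≤ √((A.filter (fun f => a + d ≤ X f)).card : ℝ) +
      √((A.filter (fun f => X f ≤ a)).card : ℝ) := by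
  by_contra! H
  have hA : A.Nonempty := by
    rw [Finset.nonempty_iff_ne_empty]; rintro rfl; simp at hV
  obtain ⟨m, hm1, hm2⟩ := exists_median A hA X
  have h1 := tail_sum A X d m hd (by exact_mod_cast hm1) H
  have h2 := tail_sum A (fun f => - X f) d (-m) hd (by simp only [neg_lt_neg_iff]; exact_mod_cast hm2) (by
    intro a
    have := H (-a - d)
    rw [add_comm (√_)] at this
    have e1 : A.filter (fun f => a + d ≤ - X f) = A.filter (fun f => X f ≤ -a - d) := by
      apply Finset.filter_congr; intro f _; constructor <;> intro <;> linarith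
    have e2 : A.filter (fun f => - X f ≤ a) = A.filter (fun f => -a - d + d ≤ X f) := by
      apply Finset.filter_congr; intro f _; constructor <;> intro <;> linarith
    rw [e1, e2]
    exact fun h1 h2 => this h2 h1)
  have h3 : ∀ f, (X f - m) ^ 2 = (max (X f - m) 0) ^ 2 + (max (-X f - -m) 0) ^ 2 := by
    intro f
    rcases le_total (X f) m with h | h
    · rw [max_eq_right (by linarith), max_eq_left (by linarith)]; ring
    · rw [max_eq_left (by linarith), max_eq_right (by linarith)]; ring
  have h4 : ∑ f ∈ A, (X f - m) ^ 2 ≤ 6 * d ^ 2 * A.card := by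
    simp_rw [h3]
    rw [Finset.sum_add_distrib]
    linarith
  have h5 : ∑ f ∈ A, ∑ g ∈ A, (X f - X g) ^ 2 ≤ 2 * A.card * ∑ f ∈ A, (X f - m) ^ 2 := by
    have e : ∀ f g, (X f - X g) ^ 2 = (X f - m) ^ 2 + (X g - m) ^ 2 - 2 * ((X f - m) * (X g - m)) := by
      intro f g; ring
    simp_rw [e, Finset.sum_sub_distrib, Finset.sum_add_distrib, ← Finset.mul_sum, ← Finset.sum_mul]
    simp only [Finset.sum_const, nsmul_eq_mul, ← Finset.mul_sum]
    nlinarith [sq_nonneg (∑ f ∈ A, (X f - m))]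
  have h6 : (0:ℝ) ≤ A.card := Nat.cast_nonneg _
  nlinarith

open ProbabilityTheory in
lemma ellNormSq_eq {X : Type*} [NormedAddCommGroup X] [NormedSpace ℝ X]
    {n : ℕ} (T : EuclideanSpace ℝ (Fin n) →L[ℝ] X) :
    ellNormSq T = ∫ x, ‖T x‖ ^ 2 ∂(stdGaussian (EuclideanSpace ℝ (Fin n))) := by
  rw [← map_pi_eq_stdGaussian, integral_map]
  · rfl
  · fun_prop
  · apply Continuous.aestronglyMeasurable
    fun_prop

open ProbabilityTheory in
lemma map_inner_std {n : ℕ} (u : EuclideanSpace ℝ (Fin n)) :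
    (stdGaussian (EuclideanSpace ℝ (Fin n))).map (fun x => inner ℝ u x) =
      (gaussianReal 0 1).map (fun x => ‖u‖ * x) := by
  have h := IsGaussian.map_eq_gaussianReal (μ := stdGaussian (EuclideanSpace ℝ (Fin n)))
    (innerSL ℝ u)
  rw [integral_strongDual_stdGaussian, variance_dual_stdGaussian, innerSL_apply_norm] at h
  rw [gaussianReal_map_const_mul]
  have e : NNReal.mk (‖u‖ ^ 2) (sq_nonneg _) * 1 = (‖u‖ ^ 2).toNNReal := by
    ext; simp
  rw [mul_zero, e]
  exact h

open ProbabilityTheory in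
lemma exp_sq_real :
    Integrable (fun x : ℝ => Real.exp (x ^ 2 / 4)) (gaussianReal 0 1) ∧
      ∫ x, Real.exp (x ^ 2 / 4) ∂(gaussianReal 0 1) = √2 := by
  have hp : ∀ x : ℝ, gaussianPDFReal 0 1 x • Real.exp (x ^ 2 / 4) =
      (√(2 * Real.pi))⁻¹ * Real.exp (-(1/4) * x ^ 2) := by
    intro x
    rw [gaussianPDFReal, smul_eq_mul, mul_assoc, ← Real.exp_add]
    simp
    left
    ring
  constructor
  · rw [gaussianReal_of_var_ne_zero _ one_ne_zero,
      integrable_withDensity_iff_integrable_smul' (measurable_gaussianPDF _ _)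
        (ae_of_all _ fun _ ↦ gaussianPDF_lt_top)]
    simp only [toReal_gaussianPDF, hp]
    exact (integrable_exp_neg_mul_sq (by norm_num)).const_mul _
  · rw [integral_gaussianReal_eq_integral_smul one_ne_zero]
    simp_rw [hp]
    rw [integral_const_mul, integral_gaussian]
    rw [← Real.sqrt_inv, ← Real.sqrt_mul (by positivity)]
    congr 1
    field_simp
    norm_num

open ProbabilityTheory in
lemma exp_sq_inner {n : ℕ} (u : EuclideanSpace ℝ (Fin n)) (r : ℝ) (hr : 0 < r) (hu : ‖u‖ ≤ r) :
    Integrable (fun x => Real.exp ((inner ℝ u x) ^ 2 / (4 * r ^ 2))) (stdGaussian (EuclideanSpace ℝ (Fin n)))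
    ∧ ∫ x, Real.exp ((inner ℝ u x) ^ 2 / (4 * r ^ 2)) ∂(stdGaussian (EuclideanSpace ℝ (Fin n))) ≤ √2 := by
  have hle : ∀ x : ℝ, Real.exp ((‖u‖ * x) ^ 2 / (4 * r ^ 2)) ≤ Real.exp (x ^ 2 / 4) := by
    intro x
    apply Real.exp_le_exp.2
    rw [div_le_div_iff₀ (by positivity) (by norm_num), mul_pow]
    have : ‖u‖ ^ 2 ≤ r ^ 2 := by gcongr
    nlinarith [mul_le_mul_of_nonneg_right this (sq_nonneg x)]
  have hi : Integrable (fun x => Real.exp ((‖u‖ * x) ^ 2 / (4 * r ^ 2))) (gaussianReal 0 1) := by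
    refine exp_sq_real.1.mono' (Continuous.aestronglyMeasurable (by fun_prop)) (ae_of_all _ fun x => ?_)
    rw [Real.norm_of_nonneg (Real.exp_nonneg _)]
    exact hle x
  have hm : AEMeasurable (fun x => inner ℝ u x) (stdGaussian (EuclideanSpace ℝ (Fin n))) :=
    Continuous.aemeasurable (by fun_prop)
  have hm2 : AEMeasurable (fun x => ‖u‖ * x) (gaussianReal 0 1) := Continuous.aemeasurable (by fun_prop)
  have hc : ∀ μ : Measure ℝ, AEStronglyMeasurable (fun y : ℝ => Real.exp (y ^ 2 / (4 * r ^ 2))) μ :=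
    fun μ => Continuous.aestronglyMeasurable (by fun_prop)
  constructor
  · have := (integrable_map_measure (hc _) hm2).2 hi
    rw [← map_inner_std u] at this
    exact (integrable_map_measure (hc _) hm).1 this
  · have h1 := integral_map hm (hc _)
    have h2 := integral_map hm2 (hc _)
    rw [← h1, map_inner_std, h2]
    exact (integral_mono hi exp_sq_real.1 hle).trans_eq exp_sq_real.2

open ProbabilityTheory in
lemma sq_norm_std (n : ℕ) :
    Integrable (fun x => ‖x‖ ^ 2) (stdGaussian (EuclideanSpace ℝ (Fin n))) ∧
    ∫ x, ‖x‖ ^ 2 ∂(stdGaussian (EuclideanSpace ℝ (Fin n))) = n := by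
  have hL : ∀ i : Fin n, Integrable (fun x : EuclideanSpace ℝ (Fin n) => (x i) ^ 2) (stdGaussian (EuclideanSpace ℝ (Fin n)))
      ∧ ∫ x : EuclideanSpace ℝ (Fin n), (x i) ^ 2 ∂(stdGaussian (EuclideanSpace ℝ (Fin n))) = 1 := by
    intro i
    set L : StrongDual ℝ (EuclideanSpace ℝ (Fin n)) := innerSL ℝ (EuclideanSpace.single i 1)
    have hLx : ∀ x, L x = x i := by intro x; simp [L, EuclideanSpace.inner_single_left]
    have h2 : MemLp L 2 (stdGaussian (EuclideanSpace ℝ (Fin n))) := IsGaussian.memLp_dual _ _ _ (by simp)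
    have hv := variance_dual_stdGaussian L
    have hm := integral_strongDual_stdGaussian L
    rw [variance_eq_integral h2.1.aemeasurable, hm] at hv
    have hn : ‖L‖ = 1 := by simp [L]
    simp only [sub_zero, hLx, hn] at hv
    refine ⟨?_, by simpa using hv⟩
    have := h2.integrable_sq
    simpa only [hLx] using this
  have e : ∀ x : EuclideanSpace ℝ (Fin n), ‖x‖ ^ 2 = ∑ i, (x i) ^ 2 := fun x => EuclideanSpace.real_norm_sq_eq x
  simp_rw [e]
  refine ⟨integrable_finsetSum _ fun i _ => (hL i).1, ?_⟩
  rw [integral_finsetSum _ fun i _ => (hL i).1]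
  simp [hL]

open ProbabilityTheory in
lemma max_bound {n : ℕ} (D : Finset (EuclideanSpace ℝ (Fin n))) (h0 : 0 ∈ D) (r : ℝ) (hr : 0 < r)
    (hD : ∀ u ∈ D, ‖u‖ ≤ r) :
    ∃ F : EuclideanSpace ℝ (Fin n) → ℝ, Integrable F (stdGaussian (EuclideanSpace ℝ (Fin n))) ∧
      (∀ u ∈ D, ∀ x, (inner ℝ u x) ^ 2 ≤ F x) ∧
      ∫ x, F x ∂(stdGaussian (EuclideanSpace ℝ (Fin n))) ≤ 8 * r ^ 2 * Real.log D.card := by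
  have hpos : 0 < D.card := Finset.card_pos.2 ⟨0, h0⟩
  rcases Nat.lt_or_ge D.card 2 with h1 | h2
  · refine ⟨fun _ => 0, integrable_zero _ _ _, ?_, ?_⟩
    · intro u hu x
      have : u = 0 := Finset.card_le_one.1 (by omega) u hu 0 h0
      simp [this]
    · have : D.card = 1 := by omega
      simp [this]
  · set N : ℝ := (D.card : ℝ) with hN
    have hN2 : (2 : ℝ) ≤ N := by rw [hN]; exact_mod_cast h2
    set a : ℝ := N * √2 with ha
    have ha0 : 0 < a := by positivity
    set S : EuclideanSpace ℝ (Fin n) → ℝ := fun x => ∑ u ∈ D, Real.exp ((inner ℝ u x) ^ 2 / (4 * r ^ 2)) with hS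
    have hSi : Integrable S (stdGaussian (EuclideanSpace ℝ (Fin n))) :=
      integrable_finsetSum _ fun u hu => (exp_sq_inner u r hr (hD u hu)).1
    have hSint : ∫ x, S x ∂(stdGaussian (EuclideanSpace ℝ (Fin n))) ≤ a := by
      rw [hS, integral_finsetSum _ fun u hu => (exp_sq_inner u r hr (hD u hu)).1]
      refine (Finset.sum_le_sum fun u hu => (exp_sq_inner u r hr (hD u hu)).2).trans ?_
      rw [Finset.sum_const, nsmul_eq_mul]
    refine ⟨fun x => 4 * r ^ 2 * (S x / a + (Real.log a - 1)), ?_, ?_, ?_⟩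
    · exact ((hSi.div_const a).add (integrable_const _)).const_mul _
    · intro u hu x
      have h1 : Real.exp ((inner ℝ u x) ^ 2 / (4 * r ^ 2)) ≤ S x :=
        Finset.single_le_sum (f := fun u => Real.exp ((inner ℝ u x) ^ 2 / (4 * r ^ 2)))
          (fun _ _ => Real.exp_nonneg _) hu
      have hSpos : 0 < S x := (Real.exp_pos _).trans_le h1
      have h2 : (inner ℝ u x) ^ 2 / (4 * r ^ 2) ≤ Real.log (S x) := (Real.le_log_iff_exp_le hSpos).2 h1
      have h3 := Real.log_le_sub_one_of_pos (div_pos hSpos ha0)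
      rw [Real.log_div hSpos.ne' ha0.ne'] at h3
      rw [div_le_iff₀ (by positivity)] at h2
      have : (0:ℝ) < 4 * r ^ 2 := by positivity
      nlinarith
    · rw [integral_const_mul, integral_add (hSi.div_const a) (integrable_const _), integral_div]
      simp only [integral_const, probReal_univ, one_smul]
      have h1 : (∫ x, S x ∂(stdGaussian (EuclideanSpace ℝ (Fin n)))) / a ≤ 1 := (div_le_one ha0).2 hSint
      have h2 : Real.log a ≤ 2 * Real.log N := by
        rw [ha, Real.log_mul (by positivity) (by positivity)]
        have : Real.log √2 ≤ Real.log N := by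
          apply Real.log_le_log (by positivity)
          refine le_trans ?_ hN2
          rw [Real.sqrt_le_left (by norm_num)]; norm_num
        linarith
      have : (0:ℝ) < 4 * r ^ 2 := by positivity
      nlinarith

open Classical in
lemma sqrt_card_le {n : ℕ} (hn : 0 < n) {t : ℝ} (ht : 0 < t) (U : Finset (Fin n → Option ℤ)) (k : ℕ) :
    ∀ A : Finset (EuclideanSpace ℝ (Fin n)), A.card = k →
    (∀ f ∈ A, ∀ g ∈ A, f ≠ g → t ≤ ‖f - g‖) →
    (∀ p, Shat (t / (10 * √n)) A p → p ∈ U) →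
    √(A.card : ℝ) ≤ ((U.filter (Shat (t / (10 * √n)) A)).card : ℝ) := by
  have hsn : 0 < √(n : ℝ) := Real.sqrt_pos.2 (by exact_mod_cast hn)
  have hsn2 : √(n : ℝ) ^ 2 = n := Real.sq_sqrt (by positivity)
  set h := t / (10 * √n) with hh
  have hpos : 0 < h := by positivity
  induction k using Nat.strong_induction_on with
  | _ k ih =>
  intro A hAk hsep hU
  rcases Nat.lt_or_ge A.card 2 with h1 | h2
  · rcases A.eq_empty_or_nonempty with he | ⟨f, hf⟩
    · rw [he]; simp
    · have hs : Shat h A (fun _ => none) := by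
        intro e
        refine ⟨f, hf, ?_⟩
        intro i b hb
        exact absurd hb (by simp)
      have h3 : 1 ≤ (U.filter (Shat h A)).card :=
        Finset.card_pos.2 ⟨_, Finset.mem_filter.2 ⟨hU _ hs, hs⟩⟩
      have h4 : √(A.card : ℝ) ≤ 1 := by
        rw [Real.sqrt_le_one]
        exact_mod_cast (by omega : A.card ≤ 1)
      exact h4.trans (by exact_mod_cast h3)
  · set N : ℝ := (A.card : ℝ) with hN
    have hN2 : (2 : ℝ) ≤ N := by rw [hN]; exact_mod_cast h2
    set d := t / (5 * √n) with hd
    have hdpos : 0 < d := by positivity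
    have htot : N * (N - 1) * t ^ 2 ≤ ∑ f ∈ A, ∑ g ∈ A, ‖f - g‖ ^ 2 := by
      have hin : ∀ f ∈ A, (N - 1) * t ^ 2 ≤ ∑ g ∈ A, ‖f - g‖ ^ 2 := by
        intro f hf
        rw [← Finset.add_sum_erase A _ hf]
        have : ∀ g ∈ A.erase f, t ^ 2 ≤ ‖f - g‖ ^ 2 := by
          intro g hg
          have := hsep f hf g (Finset.mem_of_mem_erase hg) (Finset.ne_of_mem_erase hg).symm
          gcongr
        have h5 := Finset.card_nsmul_le_sum _ _ _ this
        rw [Finset.card_erase_of_mem hf, nsmul_eq_mul, Nat.cast_sub (by omega)] at h5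
        simp only [Nat.cast_one] at h5
        simpa using h5
      have h6 := Finset.card_nsmul_le_sum _ _ _ hin
      rw [nsmul_eq_mul] at h6
      linarith
    obtain ⟨i, hi⟩ : ∃ i : Fin n, 12 * d ^ 2 * N ^ 2 < ∑ f ∈ A, ∑ g ∈ A, (f i - g i) ^ 2 := by
      by_contra! hcon
      have h7 : ∑ f ∈ A, ∑ g ∈ A, ‖f - g‖ ^ 2 = ∑ i : Fin n, ∑ f ∈ A, ∑ g ∈ A, (f i - g i) ^ 2 := by
        symm
        rw [Finset.sum_comm]
        apply Finset.sum_congr rfl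
        intro f _
        rw [Finset.sum_comm]
        apply Finset.sum_congr rfl
        intro g _
        rw [EuclideanSpace.real_norm_sq_eq]
        simp
      have h8 := Finset.sum_le_sum fun (i : Fin n) (_ : i ∈ Finset.univ) => hcon i
      rw [← h7, Finset.sum_const, Finset.card_univ, Fintype.card_fin, nsmul_eq_mul] at h8
      have h9 : (n : ℝ) * (12 * d ^ 2 * N ^ 2) = 12 / 25 * t ^ 2 * N ^ 2 := by
        rw [hd, div_pow, mul_pow, hsn2]; field_simp; norm_num
      rw [h9] at h8
      have ht2 : 0 < t ^ 2 := by positivity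
      nlinarith [mul_pos ht2 (show 0 < N by linarith)]
    obtain ⟨a, hPn, hNn, hle⟩ := small_dev A (fun f => f i) d hdpos hi
    set P := A.filter (fun f => a + d ≤ f i) with hP
    set Q := A.filter (fun f => f i ≤ a) with hQ
    have hdis : Disjoint P Q := by
      rw [Finset.disjoint_left]
      intro f hf hg
      have := (Finset.mem_filter.1 hf).2
      have := (Finset.mem_filter.1 hg).2
      linarith
    have hPA : P ⊆ A := Finset.filter_subset _ _
    have hQA : Q ⊆ A := Finset.filter_subset _ _
    have hcard : P.card + Q.card ≤ A.card := by
      rw [← Finset.card_union_of_disjoint hdis]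
      exact Finset.card_le_card (Finset.union_subset hPA hQA)
    have hPp := Finset.card_pos.2 hPn
    have hQp := Finset.card_pos.2 hNn
    have iP := ih P.card (by omega) P rfl (fun f hf g hg => hsep f (hPA hf) g (hPA hg))
      (fun p hp => hU p (hp.mono hPA))
    have iQ := ih Q.card (by omega) Q rfl (fun f hf g hg => hsep f (hQA hf) g (hQA hg))
      (fun p hp => hU p (hp.mono hQA))
    have hd2 : d = 2 * h := by rw [hd, hh]; field_simp; norm_num
    set b : ℤ := ⌈a / h⌉ with hb
    have hb1 : a ≤ b * h := by
      rw [← div_le_iff₀ hpos]; exact Int.le_ceil _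
    have hb2 : ((b : ℝ) + 1) * h ≤ a + d := by
      have := Int.ceil_lt_add_one (a / h)
      rw [← hb, ← sub_lt_iff_lt_add, lt_div_iff₀ hpos] at this
      rw [hd2]; linarith
    have hsplit := shat_split hpos hPA hQA i b
      (fun f hf => hb2.trans (Finset.mem_filter.1 hf).2)
      (fun f hf => (Finset.mem_filter.1 hf).2.trans hb1) U hU
    have hsplit' : ((U.filter (Shat h P)).card : ℝ) + ((U.filter (Shat h Q)).card : ℝ) ≤
        ((U.filter (Shat h A)).card : ℝ) := by exact_mod_cast hsplit
    linarith

lemma geo_bound (s : ℝ) (hs : 0 < s) (hs1 : s ≤ 1) (B : ℕ) :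
    ∑ k ∈ Finset.range (B + 1), Real.exp (-(s * k)) ≤ 2 / s := by
  have e : ∀ k : ℕ, Real.exp (-(s * k)) = Real.exp (-s) ^ k := by
    intro k; rw [← Real.exp_nat_mul]; congr 1; ring
  simp_rw [e]
  have h1 := mul_neg_geom_sum (Real.exp (-s)) (B + 1)
  have h2 : s / 2 ≤ 1 - Real.exp (-s) := by
    have h3 : Real.exp (-s) ≤ 1 / (1 + s) := by
      rw [Real.exp_neg, ← one_div]
      apply one_div_le_one_div_of_le (by linarith)
      linarith [Real.add_one_le_exp s]
    have h4 : 1 / (1 + s) ≤ 1 - s / 2 := by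
      rw [div_le_iff₀ (by linarith)]; nlinarith
    linarith
  have h5 : 0 ≤ ∑ k ∈ Finset.range (B + 1), Real.exp (-s) ^ k :=
    Finset.sum_nonneg fun _ _ => by positivity
  have h6 : 0 < Real.exp (-s) ^ (B + 1) := by positivity
  rw [le_div_iff₀ hs]
  nlinarith

def zset (B : ℕ) : Finset ℤ :=
  (Finset.range (B + 1)).image (fun k : ℕ => (k : ℤ)) ∪ (Finset.range (B + 1)).image (fun k : ℕ => -(k : ℤ))

lemma mem_zset {B : ℕ} {b : ℤ} (h : b.natAbs ≤ B) : b ∈ zset B := by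
  unfold zset
  rw [Finset.mem_union, Finset.mem_image, Finset.mem_image]
  rcases Int.natAbs_eq b with h1 | h1
  · exact Or.inl ⟨b.natAbs, Finset.mem_range.2 (by omega), h1.symm⟩
  · exact Or.inr ⟨b.natAbs, Finset.mem_range.2 (by omega), h1.symm⟩

lemma zset_sum (s : ℝ) (hs : 0 < s) (hs1 : s ≤ 1) (B : ℕ) :
    ∑ b ∈ zset B, Real.exp (-(s * |(b : ℝ)|)) ≤ 4 / s := by
  unfold zset
  have h := Finset.sum_union_inter (s₁ := (Finset.range (B + 1)).image (fun k : ℕ => (k : ℤ)))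
    (s₂ := (Finset.range (B + 1)).image (fun k : ℕ => -(k : ℤ))) (f := fun b : ℤ => Real.exp (-(s * |(b : ℝ)|)))
  rw [Finset.sum_image (by intro a _ b _ h; simpa using h),
    Finset.sum_image (by intro a _ b _ h; simpa using h)] at h
  simp only [Int.cast_natCast, Int.cast_neg, abs_neg, Nat.abs_cast] at h
  have h2 := geo_bound s hs hs1 B
  have h3 : 0 ≤ ∑ x ∈ (Finset.range (B + 1)).image (fun k : ℕ => (k : ℤ)) ∩ (Finset.range (B + 1)).image (fun k : ℕ => -(k : ℤ)), Real.exp (-(s * |(x : ℝ)|)) :=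
    Finset.sum_nonneg fun _ _ => by positivity
  have h4 : 4 / s = 2 / s + 2 / s := by ring
  linarith

noncomputable def cst (l s : ℝ) (o : Option ℤ) : ℝ := o.elim 0 (fun b => l + s * |(b : ℝ)|)

lemma count_bound {n : ℕ} (l s C : ℝ) (hs : 0 < s) (hs1 : s ≤ 1) (B : ℕ)
    (U : Finset (Fin n → Option ℤ)) (hU : U ⊆ Fintype.piFinset (fun _ => (zset B).insertNone))
    (hC : ∀ p ∈ U, ∑ i, cst l s (p i) ≤ C) :
    (U.card : ℝ) ≤ Real.exp (C + n * (Real.exp (-l) * (4 / s))) := by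
  have h1 : (U.card : ℝ) ≤ ∑ p ∈ U, Real.exp C * ∏ i, Real.exp (- cst l s (p i)) := by
    rw [Finset.card_eq_sum_ones, Nat.cast_sum]
    apply Finset.sum_le_sum
    intro p hp
    rw [← Real.exp_sum, ← Real.exp_add, Finset.sum_neg_distrib, Nat.cast_one]
    apply Real.one_le_exp
    linarith [hC p hp]
  refine h1.trans ?_
  rw [← Finset.mul_sum, Real.exp_add]
  gcongr
  calc ∑ p ∈ U, ∏ i, Real.exp (- cst l s (p i))
      ≤ ∑ p ∈ Fintype.piFinset (fun _ => (zset B).insertNone), ∏ i : Fin n, Real.exp (- cst l s (p i)) :=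
        Finset.sum_le_sum_of_subset_of_nonneg hU fun _ _ _ => Finset.prod_nonneg fun _ _ => by positivity
    _ = ∏ i : Fin n, ∑ o ∈ (zset B).insertNone, Real.exp (- cst l s o) := by
        rw [Finset.prod_univ_sum]
    _ = (∑ o ∈ (zset B).insertNone, Real.exp (- cst l s o)) ^ n := by simp
    _ ≤ (Real.exp (Real.exp (-l) * (4 / s))) ^ n := by
        gcongr
        rw [Finset.sum_insertNone]
        simp only [cst, Option.elim]
        have : ∀ b : ℤ, Real.exp (-(l + s * |(b : ℝ)|)) = Real.exp (-l) * Real.exp (-(s * |(b : ℝ)|)) := by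
          intro b; rw [← Real.exp_add]; congr 1; ring
        simp_rw [this, ← Finset.mul_sum]
        have h2 := zset_sum s hs hs1 B
        have h3 := Real.add_one_le_exp (Real.exp (-l) * (4 / s))
        have h4 : Real.exp (-l) * ∑ b ∈ zset B, Real.exp (-(s * |(b : ℝ)|)) ≤ Real.exp (-l) * (4 / s) := by gcongr
        simp only [neg_zero, Real.exp_zero]
        linarith
    _ = _ := by rw [← Real.exp_nat_mul]

def KT {X : Type*} [NormedAddCommGroup X] [NormedSpace ℝ X]
    {n : ℕ} (T : EuclideanSpace ℝ (Fin n) →L[ℝ] X) : Set (EuclideanSpace ℝ (Fin n)) :=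
  {f | ∃ φ : X →L[ℝ] ℝ, ‖φ‖ ≤ 1 ∧ ∀ x, inner ℝ f x = φ (T x)}

lemma KT_norm {X : Type*} [NormedAddCommGroup X] [NormedSpace ℝ X]
    {n : ℕ} (T : EuclideanSpace ℝ (Fin n) →L[ℝ] X) {f : EuclideanSpace ℝ (Fin n)} (hf : f ∈ KT T) :
    ‖f‖ ≤ ‖T‖ := by
  obtain ⟨φ, hφ, h⟩ := hf
  have h1 := h f
  rw [real_inner_self_eq_norm_sq] at h1
  have h2 : φ (T f) ≤ ‖T‖ * ‖f‖ := by
    calc φ (T f) ≤ ‖φ (T f)‖ := Real.le_norm_self _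
      _ ≤ ‖φ‖ * ‖T f‖ := φ.le_opNorm _
      _ ≤ 1 * (‖T‖ * ‖f‖) := by gcongr; exact T.le_opNorm f
      _ = _ := one_mul _
  by_contra! hc
  have : 0 < ‖f‖ := (norm_nonneg _).trans_lt hc
  nlinarith

lemma shat_lower {X : Type*} [NormedAddCommGroup X] [NormedSpace ℝ X]
    {n : ℕ} (T : EuclideanSpace ℝ (Fin n) →L[ℝ] X) {h : ℝ} {A : Finset (EuclideanSpace ℝ (Fin n))}
    (hA : ∀ f ∈ A, f ∈ KT T) {p : Fin n → Option ℤ} (hp : Shat h A p)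
    (x : EuclideanSpace ℝ (Fin n))
    (hx : ∀ i ∉ Finset.univ.filter (fun i => (p i).isSome), x i = 0) :
    h / 2 * ∑ i ∈ Finset.univ.filter (fun i => (p i).isSome), |x i| ≤ ‖T x‖ := by
  obtain ⟨f, hf, Hf⟩ := hp (fun i => decide (0 ≤ x i))
  obtain ⟨g, hg, Hg⟩ := hp (fun i => !decide (0 ≤ x i))
  obtain ⟨φ, hφ, eφ⟩ := hA f hf
  obtain ⟨ψ, hψ, eψ⟩ := hA g hg
  have h1 : inner ℝ (f - g) x ≤ 2 * ‖T x‖ := by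
    rw [inner_sub_left, eφ, eψ]
    have a1 := (Real.le_norm_self _).trans (φ.le_of_opNorm_le hφ (T x))
    have a2 := (neg_le_abs _).trans (ψ.le_of_opNorm_le hψ (T x))
    linarith
  have h2 : h * ∑ i ∈ Finset.univ.filter (fun i => (p i).isSome), |x i| ≤ inner ℝ (f - g) x := by
    have e : inner ℝ (f - g) x = ∑ i, (f i - g i) * x i := by
      rw [PiLp.inner_apply]
      apply Finset.sum_congr rfl
      intro i _
      simp [mul_comm]
    rw [e, Finset.mul_sum, ← Finset.sum_subset (Finset.subset_univ (Finset.univ.filter (fun i => (p i).isSome)))]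
    · apply Finset.sum_le_sum
      intro i hi
      obtain ⟨b, hb⟩ := Option.isSome_iff_exists.1 (Finset.mem_filter.1 hi).2
      have Hf' := Hf i b hb
      have Hg' := Hg i b hb
      by_cases h0 : 0 ≤ x i
      · rw [abs_of_nonneg h0]
        have b1 := Hf'.1 (by simpa using h0)
        have b2 := Hg'.2 (by simpa using h0)
        apply mul_le_mul_of_nonneg_right _ h0
        linarith
      · have h0' := not_le.1 h0
        rw [abs_of_neg h0']
        have b1 := Hf'.2 (by simpa using h0')
        have b2 := Hg'.1 (by simpa using h0')
        nlinarith
    · intro i _ hi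
      rw [hx i hi, mul_zero]
  linarith

open Classical in
lemma entropy {X : Type*} [NormedAddCommGroup X] [NormedSpace ℝ X]
    {n : ℕ} (hn : 0 < n) (T : EuclideanSpace ℝ (Fin n) →L[ℝ] X) (c α : ℝ) (hc1 : c ≤ 1)
    (hα : 0 < α) (hα1 : α ≤ 1) (hM : 1 ≤ ‖T‖)
    (H : ∀ s : Finset (Fin n), c * α ^ 2 * n / ‖T‖ ^ 2 ≤ s.card →
      ∃ x : EuclideanSpace ℝ (Fin n), (∀ i ∉ s, x i = 0) ∧
          ‖T x‖ < α * ((s.card : ℝ) ^ (-(1 / 2) : ℝ)) * ∑ i ∈ s, |x i|)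
    (t : ℝ) (ht : 0 < t) (htM : t ≤ ‖T‖) (A : Finset (EuclideanSpace ℝ (Fin n)))
    (hA : ∀ f ∈ A, f ∈ KT T) (hA0 : A.Nonempty)
    (hsep : ∀ f ∈ A, ∀ g ∈ A, f ≠ g → t ≤ ‖f - g‖) :
    Real.log A.card ≤ 400 * α ^ 2 * n / t ^ 2 * (6 * Real.log (‖T‖ / α) + 3) := by
  set M := ‖T‖ with hMdef
  have hM0 : 0 < M := by linarith
  have hnR : (0 : ℝ) < n := by exact_mod_cast hn
  have hsn : 0 < √(n : ℝ) := Real.sqrt_pos.2 hnR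
  have hsn2 : √(n : ℝ) ^ 2 = n := Real.sq_sqrt (by positivity)
  set V := 400 * α ^ 2 * n / t ^ 2 with hV
  have hV0 : 0 < V := by positivity
  set h := t / (10 * √n) with hh
  have hpos : 0 < h := by positivity
  have hVh : V * h ^ 2 = 4 * α ^ 2 := by
    rw [hV, hh, div_pow, mul_pow, hsn2]; field_simp; norm_num
  set s := α / M with hs
  have hs0 : 0 < s := by positivity
  have hs1 : s ≤ 1 := by rw [hs, div_le_one hM0]; linarith
  set l := 3 * Real.log (M / α) with hl
  have hl0 : 0 ≤ l := by
    have : 0 ≤ Real.log (M / α) := Real.log_nonneg (by rw [le_div_iff₀ hα]; linarith)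
    positivity
  set B := ⌈M / h⌉₊ with hB
  -- facts about shattered patterns
  have fact1 : ∀ p, Shat h A p →
      ((Finset.univ.filter (fun i => (p i).isSome)).card : ℝ) ≤ V := by
    intro p hp
    set S := Finset.univ.filter (fun i => (p i).isSome) with hS
    by_cases hk : c * α ^ 2 * n / M ^ 2 ≤ S.card
    · obtain ⟨x, hx0, hx⟩ := H S hk
      have h1 := (shat_lower T hA hp x hx0).trans_lt hx
      have hsum : 0 ≤ ∑ i ∈ S, |x i| := Finset.sum_nonneg fun _ _ => abs_nonneg _
      have h2 : h / 2 < α * ((S.card : ℝ) ^ (-(1 / 2) : ℝ)) := lt_of_mul_lt_mul_right h1 hsum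
      rcases Nat.eq_zero_or_pos S.card with h0 | hpS
      · rw [h0]; simpa using hV0.le
      · have hkR : (0 : ℝ) < S.card := by exact_mod_cast hpS
        have e : ((S.card : ℝ) ^ (-(1 / 2) : ℝ)) = (√(S.card : ℝ))⁻¹ := by
          rw [Real.rpow_neg hkR.le, ← Real.sqrt_eq_rpow]
        rw [e, ← div_eq_mul_inv, lt_div_iff₀ (Real.sqrt_pos.2 hkR)] at h2
        have h3 : (h / 2 * √(S.card : ℝ)) ^ 2 ≤ α ^ 2 := by
          apply pow_le_pow_left₀ (by positivity) h2.le
        rw [mul_pow, Real.sq_sqrt hkR.le] at h3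
        have h4 : h ^ 2 * S.card ≤ h ^ 2 * V := by nlinarith
        exact le_of_mul_le_mul_left h4 (by positivity)
    · refine (not_le.1 hk).le.trans ?_
      rw [hV]
      have : c * α ^ 2 * n ≤ 400 * α ^ 2 * n := by gcongr; linarith
      calc c * α ^ 2 * n / M ^ 2 ≤ 400 * α ^ 2 * n / M ^ 2 := by gcongr
        _ ≤ 400 * α ^ 2 * n / t ^ 2 := by gcongr
  have fact2 : ∀ p, Shat h A p → ∃ f ∈ A, ∀ i b, p i = some b → h * |(b : ℝ)| ≤ |f i| := by
    intro p hp
    obtain ⟨f, hf, Hf⟩ := hp (fun i => (p i).elim true (fun b => decide (0 ≤ b)))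
    refine ⟨f, hf, fun i b hb => ?_⟩
    have := Hf i b hb
    simp only [hb, Option.elim, decide_eq_true_eq, decide_eq_false_iff_not, not_le] at this
    rcases le_or_gt 0 b with h0 | h0
    · have h1 := this.1 h0
      have h0R : (0 : ℝ) ≤ b := by exact_mod_cast h0
      rw [abs_of_nonneg h0R]
      refine le_trans ?_ (le_abs_self _)
      linarith
    · have h1 := this.2 h0
      have h0R : (b : ℝ) < 0 := by exact_mod_cast h0
      rw [abs_of_neg h0R]
      refine le_trans ?_ (neg_le_abs _)
      linarith
  set U : Finset (Fin n → Option ℤ) := Fintype.piFinset (fun _ => (zset B).insertNone) with hU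
  have hmem : ∀ p, Shat h A p → p ∈ U := by
    intro p hp
    obtain ⟨f, hf, Hf⟩ := fact2 p hp
    rw [hU, Fintype.mem_piFinset]
    intro i
    cases hpi : p i with
    | none => exact Finset.none_mem_insertNone
    | some b =>
      rw [Finset.some_mem_insertNone]
      apply mem_zset
      have h1 := Hf i b hpi
      have h2 : |f i| ≤ M := (PiLp.norm_apply_le f i).trans (KT_norm T (hA f hf))
      have h3 : |(b : ℝ)| ≤ M / h := by rw [le_div_iff₀ hpos]; linarith
      have h4 : |(b : ℝ)| = (b.natAbs : ℝ) := by
        rw [Nat.cast_natAbs, Int.cast_abs]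
      rw [h4] at h3
      exact_mod_cast h3.trans (Nat.le_ceil _)
  have hcost : ∀ p ∈ U.filter (Shat h A), ∑ i, cst l s (p i) ≤ V * (l + 1 / 2) := by
    intro p hp
    have hp := (Finset.mem_filter.1 hp).2
    obtain ⟨f, hf, Hf⟩ := fact2 p hp
    have hk := fact1 p hp
    set S := Finset.univ.filter (fun i => (p i).isSome) with hS
    set bv : Fin n → ℝ := fun i => (p i).elim 0 (fun b => |(b : ℝ)|) with hbv
    have e1 : ∑ i, cst l s (p i) = ∑ i ∈ S, (l + s * bv i) := by
      rw [← Finset.sum_subset (Finset.subset_univ S)]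
      · apply Finset.sum_congr rfl
        intro i hi
        obtain ⟨b, hb⟩ := Option.isSome_iff_exists.1 (Finset.mem_filter.1 hi).2
        simp [hbv, cst, hb]
      · intro i _ hi
        have : p i = none := by simpa [hS] using hi
        simp [cst, this]
    rw [e1, Finset.sum_add_distrib, Finset.sum_const, nsmul_eq_mul, ← Finset.mul_sum]
    have h1 : (h * ∑ i ∈ S, bv i) ^ 2 ≤ V * M ^ 2 := by
      rw [Finset.mul_sum]
      calc (∑ i ∈ S, h * bv i) ^ 2 ≤ S.card * ∑ i ∈ S, (h * bv i) ^ 2 := sq_sum_le_card_mul_sum_sq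
        _ ≤ V * M ^ 2 := by
          have h2 : ∑ i ∈ S, (h * bv i) ^ 2 ≤ M ^ 2 := by
            calc ∑ i ∈ S, (h * bv i) ^ 2 ≤ ∑ i ∈ S, (f i) ^ 2 := by
                  apply Finset.sum_le_sum
                  intro i hi
                  obtain ⟨b, hb⟩ := Option.isSome_iff_exists.1 (Finset.mem_filter.1 hi).2
                  have := Hf i b hb
                  rw [← sq_abs (f i)]
                  simp only [hbv, hb, Option.elim]
                  gcongr
              _ ≤ ∑ i, (f i) ^ 2 := Finset.sum_le_sum_of_subset_of_nonneg (Finset.subset_univ _)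
                  fun _ _ _ => sq_nonneg _
              _ = ‖f‖ ^ 2 := (EuclideanSpace.real_norm_sq_eq f).symm
              _ ≤ M ^ 2 := by gcongr; exact KT_norm T (hA f hf)
          have h3 : 0 ≤ ∑ i ∈ S, (h * bv i) ^ 2 := Finset.sum_nonneg fun _ _ => sq_nonneg _
          gcongr
    have h4 : s * ∑ i ∈ S, bv i ≤ V / 2 := by
      apply le_of_sq_le_sq _ (by positivity) |> fun x => x
      have h5 : h ^ 2 * (s * ∑ i ∈ S, bv i) ^ 2 ≤ h ^ 2 * (V / 2) ^ 2 := by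
        calc h ^ 2 * (s * ∑ i ∈ S, bv i) ^ 2 = s ^ 2 * (h * ∑ i ∈ S, bv i) ^ 2 := by ring
          _ ≤ s ^ 2 * (V * M ^ 2) := by gcongr
          _ = V * α ^ 2 := by rw [hs]; field_simp
          _ = V / 4 * (V * h ^ 2) := by rw [hVh]; ring
          _ = _ := by ring
      exact le_of_mul_le_mul_left h5 (by positivity)
    have h6 : (S.card : ℝ) * l ≤ V * l := by gcongr
    linarith
  have hcount := count_bound l s (V * (l + 1 / 2)) hs0 hs1 B (U.filter (Shat h A)) (Finset.filter_subset _ _) hcost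
  have hsq := sqrt_card_le hn ht U A.card A rfl hsep hmem
  have hexp : n * (Real.exp (-l) * (4 / s)) ≤ V := by
    have e1 : Real.exp (-l) = s ^ 3 := by
      have : -l = Real.log (s ^ 3) := by
        rw [Real.log_pow, hs, ← inv_div, Real.log_inv, hl]; push_cast; ring
      rw [this, Real.exp_log (by positivity)]
    rw [e1]
    have e2 : s ^ 3 * (4 / s) = 4 * s ^ 2 := by field_simp
    rw [e2, hV, hs, div_pow]
    calc (n : ℝ) * (4 * (α ^ 2 / M ^ 2)) = 4 * α ^ 2 * n / M ^ 2 := by ring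
      _ ≤ 400 * α ^ 2 * n / M ^ 2 := by gcongr; norm_num
      _ ≤ 400 * α ^ 2 * n / t ^ 2 := by gcongr
  have hAc : (0 : ℝ) < A.card := by exact_mod_cast Finset.card_pos.2 hA0
  have hfin : √(A.card : ℝ) ≤ Real.exp (V * (l + 3 / 2)) := by
    refine hsq.trans (hcount.trans ?_)
    apply Real.exp_le_exp.2
    linarith
  have := Real.log_le_log (Real.sqrt_pos.2 hAc) hfin
  rw [Real.log_exp, Real.log_sqrt hAc.le] at this
  rw [hl] at this
  linarith

open Classical in
lemma exists_net {X : Type*} [NormedAddCommGroup X] [NormedSpace ℝ X]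
    {n : ℕ} (hn : 0 < n) (T : EuclideanSpace ℝ (Fin n) →L[ℝ] X) (c α : ℝ) (hc1 : c ≤ 1)
    (hα : 0 < α) (hα1 : α ≤ 1) (hM : 1 ≤ ‖T‖)
    (H : ∀ s : Finset (Fin n), c * α ^ 2 * n / ‖T‖ ^ 2 ≤ s.card →
      ∃ x : EuclideanSpace ℝ (Fin n), (∀ i ∉ s, x i = 0) ∧
          ‖T x‖ < α * ((s.card : ℝ) ^ (-(1 / 2) : ℝ)) * ∑ i ∈ s, |x i|)
    (t : ℝ) (ht : 0 < t) (htM : t ≤ ‖T‖) :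
    ∃ A : Finset (EuclideanSpace ℝ (Fin n)), 0 ∈ A ∧ (∀ f ∈ KT T, ∃ a ∈ A, ‖f - a‖ ≤ t) ∧
      Real.log A.card ≤ 400 * α ^ 2 * n / t ^ 2 * (6 * Real.log (‖T‖ / α) + 3) := by
  set P : Finset (EuclideanSpace ℝ (Fin n)) → Prop := fun A => 0 ∈ A ∧ (∀ f ∈ A, f ∈ KT T) ∧
    (∀ f ∈ A, ∀ g ∈ A, f ≠ g → t ≤ ‖f - g‖) with hP
  set Lm := 400 * α ^ 2 * n / t ^ 2 * (6 * Real.log (‖T‖ / α) + 3) with hLm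
  have hlog : ∀ A, P A → Real.log A.card ≤ Lm := fun A hA =>
    entropy hn T c α hc1 hα hα1 hM H t ht htM A hA.2.1 ⟨0, hA.1⟩ hA.2.2
  have hbd : ∀ k, (∃ A, P A ∧ A.card = k) → k ≤ ⌈Real.exp Lm⌉₊ := by
    rintro k ⟨A, hA, rfl⟩
    have hpos : (0 : ℝ) < A.card := by exact_mod_cast Finset.card_pos.2 ⟨0, hA.1⟩
    have := (Real.log_le_iff_le_exp hpos).1 (hlog A hA)
    exact_mod_cast this.trans (Nat.le_ceil _)
  have h0 : (0 : EuclideanSpace ℝ (Fin n)) ∈ KT T := ⟨0, by simp, by simp⟩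
  have hne : ∃ A, P A ∧ A.card = 1 := by
    refine ⟨{0}, ⟨by simp, ?_, ?_⟩, by simp⟩
    · intro f hf; rw [Finset.mem_singleton.1 hf]; exact h0
    · intro f hf g hg hfg
      exact absurd ((Finset.mem_singleton.1 hf).trans (Finset.mem_singleton.1 hg).symm) hfg
  have hspec := Nat.findGreatest_spec (P := fun k => ∃ A, P A ∧ A.card = k) (hbd 1 hne) hne
  set m := Nat.findGreatest (fun k => ∃ A, P A ∧ A.card = k) ⌈Real.exp Lm⌉₊ with hm
  obtain ⟨A, hA, hAm⟩ := hspec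
  refine ⟨A, hA.1, ?_, hlog A hA⟩
  intro f hf
  by_contra! hcon
  have hfA : f ∉ A := by
    intro h
    have := hcon f h
    simp at this
    linarith
  have hA' : P (insert f A) := by
    refine ⟨Finset.mem_insert_of_mem hA.1, ?_, ?_⟩
    · intro g hg
      rcases Finset.mem_insert.1 hg with rfl | hg
      · exact hf
      · exact hA.2.1 g hg
    · intro g hg g' hg' hne
      rcases Finset.mem_insert.1 hg with h1 | h1 <;> rcases Finset.mem_insert.1 hg' with h2 | h2
      · exact absurd (h1.trans h2.symm) hne
      · rw [h1]; exact (hcon g' h2).le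
      · rw [h2, norm_sub_rev]; exact (hcon g h1).le
      · exact hA.2.2 g h1 g' h2 hne
  have hex : ∃ B, P B ∧ B.card = m + 1 := ⟨insert f A, hA', by rw [Finset.card_insert_of_notMem hfA, hAm]⟩
  have := Nat.le_findGreatest (P := fun k => ∃ A, P A ∧ A.card = k) (hbd _ hex) hex
  omega

lemma exists_KT {X : Type*} [NormedAddCommGroup X] [NormedSpace ℝ X]
    {n : ℕ} (T : EuclideanSpace ℝ (Fin n) →L[ℝ] X) (x : EuclideanSpace ℝ (Fin n)) :
    ∃ f ∈ KT T, inner ℝ f x = ‖T x‖ := by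
  obtain ⟨φ, hφ, h⟩ := exists_dual_vector'' ℝ (T x)
  have e : ∀ y, inner ℝ ((InnerProductSpace.toDual ℝ (EuclideanSpace ℝ (Fin n))).symm (φ.comp T)) y = φ (T y) := by
    intro y; rw [InnerProductSpace.toDual_symm_apply]; rfl
  exact ⟨_, ⟨φ, hφ, e⟩, by rw [e, h]; rfl⟩

lemma exists_net_seq {X : Type*} [NormedAddCommGroup X] [NormedSpace ℝ X]
    {n : ℕ} (hn : 0 < n) (T : EuclideanSpace ℝ (Fin n) →L[ℝ] X) (c α : ℝ) (hc1 : c ≤ 1)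
    (hα : 0 < α) (hα1 : α ≤ 1) (hM : 1 ≤ ‖T‖)
    (H : ∀ s : Finset (Fin n), c * α ^ 2 * n / ‖T‖ ^ 2 ≤ s.card →
      ∃ x : EuclideanSpace ℝ (Fin n), (∀ i ∉ s, x i = 0) ∧
          ‖T x‖ < α * ((s.card : ℝ) ^ (-(1 / 2) : ℝ)) * ∑ i ∈ s, |x i|)
    (j : ℕ) :
    ∃ A : Finset (EuclideanSpace ℝ (Fin n)), 0 ∈ A ∧ (∀ f ∈ KT T, ∃ a ∈ A, ‖f - a‖ ≤ ‖T‖ / 2 ^ j) ∧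
      Real.log A.card ≤ 400 * α ^ 2 * n / (‖T‖ / 2 ^ j) ^ 2 * (6 * Real.log (‖T‖ / α) + 3) ∧
      (j = 0 → A = {0}) := by
  have hM0 : 0 < ‖T‖ := by linarith
  cases j with
  | zero =>
    refine ⟨{0}, by simp, ?_, ?_, fun _ => rfl⟩
    · intro f hf
      exact ⟨0, by simp, by simpa using KT_norm T hf⟩
    · have : 0 ≤ Real.log (‖T‖ / α) := Real.log_nonneg (by rw [le_div_iff₀ hα]; linarith)
      simp only [Finset.card_singleton, Nat.cast_one, Real.log_one]
      positivity
  | succ j =>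
    obtain ⟨A, h1, h2, h3⟩ := exists_net hn T c α hc1 hα hα1 hM H (‖T‖ / 2 ^ (j + 1)) (by positivity)
      (div_le_self hM0.le (one_le_pow₀ (by norm_num)))
    exact ⟨A, h1, h2, h3, fun h => absurd h (by omega)⟩

open Classical ProbabilityTheory in
lemma chain {X : Type*} [NormedAddCommGroup X] [NormedSpace ℝ X]
    {n : ℕ} (hn : 0 < n) (T : EuclideanSpace ℝ (Fin n) →L[ℝ] X) (c α : ℝ) (hc1 : c ≤ 1)
    (hα : 0 < α) (hα1 : α ≤ 1) (hM : 1 ≤ ‖T‖)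
    (H : ∀ s : Finset (Fin n), c * α ^ 2 * n / ‖T‖ ^ 2 ≤ s.card →
      ∃ x : EuclideanSpace ℝ (Fin n), (∀ i ∉ s, x i = 0) ∧
          ‖T x‖ < α * ((s.card : ℝ) ^ (-(1 / 2) : ℝ)) * ∑ i ∈ s, |x i|)
    (J : ℕ) :
    ellNormSq T ≤ 2 * (‖T‖ / 2 ^ J) ^ 2 * n +
      2 * J * (J * (57600 * α ^ 2 * n * (6 * Real.log (‖T‖ / α) + 3))) := by
  have hM0 : 0 < ‖T‖ := by linarith
  set Λ := 6 * Real.log (‖T‖ / α) + 3 with hΛ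
  have hΛ0 : 0 ≤ Λ := by
    have : 0 ≤ Real.log (‖T‖ / α) := Real.log_nonneg (by rw [le_div_iff₀ hα]; linarith)
    positivity
  choose A hA0 hAnet hAlog hAz using exists_net_seq hn T c α hc1 hα hα1 hM H
  set t : ℕ → ℝ := fun j => ‖T‖ / 2 ^ j with ht
  have ht0 : ∀ j, 0 < t j := fun j => by positivity
  have ht2 : ∀ j, t j = 2 * t (j + 1) := fun j => by simp only [ht, pow_succ]; field_simp
  set D : ℕ → Finset (EuclideanSpace ℝ (Fin n)) := fun j =>
    ((A (j + 1) ×ˢ A j).image (fun q => q.1 - q.2)).filter (fun u => ‖u‖ ≤ 3 * t (j + 1)) with hD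
  have hD0 : ∀ j, 0 ∈ D j := by
    intro j
    refine Finset.mem_filter.2 ⟨Finset.mem_image.2 ⟨(0, 0), Finset.mem_product.2 ⟨hA0 _, hA0 _⟩, by simp⟩, ?_⟩
    have := ht0 (j + 1)
    rw [norm_zero]; positivity
  have hDlog : ∀ j, Real.log (D j).card ≤ 800 * α ^ 2 * n / (t (j + 1)) ^ 2 * Λ := by
    intro j
    have hc : (D j).card ≤ (A (j + 1)).card * (A j).card :=
      (Finset.card_filter_le _ _).trans (Finset.card_image_le.trans (Finset.card_product _ _).le)
    have hp : 0 < (D j).card := Finset.card_pos.2 ⟨0, hD0 j⟩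
    have hp1 : 0 < (A (j + 1)).card := Finset.card_pos.2 ⟨0, hA0 _⟩
    have hp2 : 0 < (A j).card := Finset.card_pos.2 ⟨0, hA0 _⟩
    have h1 : Real.log (D j).card ≤ Real.log (A (j + 1)).card + Real.log (A j).card := by
      rw [← Real.log_mul (Nat.cast_pos.2 hp1).ne' (Nat.cast_pos.2 hp2).ne']
      apply Real.log_le_log (Nat.cast_pos.2 hp)
      exact_mod_cast hc
    have h2 := hAlog (j + 1)
    have h3 := hAlog j
    have h4 : 400 * α ^ 2 * n / (t j) ^ 2 * Λ ≤ 400 * α ^ 2 * n / (t (j + 1)) ^ 2 * Λ := by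
      have := ht0 (j + 1)
      have h5 : t (j + 1) ≤ t j := by rw [ht2 j]; linarith
      gcongr
    have h6 : 800 * α ^ 2 * n / (t (j + 1)) ^ 2 * Λ = 400 * α ^ 2 * n / (t (j + 1)) ^ 2 * Λ
      + 400 * α ^ 2 * n / (t (j + 1)) ^ 2 * Λ := by ring
    rw [h6]
    change Real.log (A (j + 1)).card ≤ 400 * α ^ 2 * n / (t (j + 1)) ^ 2 * Λ at h2
    change Real.log (A j).card ≤ 400 * α ^ 2 * n / (t j) ^ 2 * Λ at h3
    linarith
  have hF := fun j => max_bound (D j) (hD0 j) (3 * t (j + 1)) (by have := ht0 (j + 1); positivity)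
    (fun u hu => (Finset.mem_filter.1 hu).2)
  choose F hFi hFle hFint using hF
  have hFint' : ∀ j, ∫ x, F j x ∂(stdGaussian (EuclideanSpace ℝ (Fin n))) ≤ 57600 * α ^ 2 * n * Λ := by
    intro j
    refine (hFint j).trans ?_
    have := ht0 (j + 1)
    calc 8 * (3 * t (j + 1)) ^ 2 * Real.log (D j).card
        ≤ 8 * (3 * t (j + 1)) ^ 2 * (800 * α ^ 2 * n / (t (j + 1)) ^ 2 * Λ) := by
          gcongr; exact hDlog j
      _ = _ := by field_simp; ring
  have hpt : ∀ x, ‖T x‖ ^ 2 ≤ 2 * (t J) ^ 2 * ‖x‖ ^ 2 + 2 * J * ∑ j ∈ Finset.range J, F j x := by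
    intro x
    obtain ⟨f, hf, hfx⟩ := exists_KT T x
    choose π hπA hπ using fun j => hAnet j f hf
    have hπ0 : π 0 = 0 := by
      have := hπA 0
      rw [hAz 0 rfl] at this
      simpa using this
    have hlink : ∀ j, (inner ℝ (π (j + 1) - π j) x) ^ 2 ≤ F j x := by
      intro j
      apply hFle
      refine Finset.mem_filter.2 ⟨Finset.mem_image.2 ⟨(π (j + 1), π j),
        Finset.mem_product.2 ⟨hπA _, hπA _⟩, rfl⟩, ?_⟩
      have e : π (j + 1) - π j = (f - π j) - (f - π (j + 1)) := by abel
      rw [e]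
      refine (norm_sub_le _ _).trans ?_
      have h1 : ‖f - π j‖ ≤ t j := hπ j
      have h2 : ‖f - π (j + 1)‖ ≤ t (j + 1) := hπ (j + 1)
      rw [ht2 j] at h1
      linarith
    have hsum : inner ℝ f x = inner ℝ (f - π J) x + ∑ j ∈ Finset.range J, inner ℝ (π (j + 1) - π j) x := by
      rw [← sum_inner, Finset.sum_range_sub, hπ0, sub_zero, ← inner_add_left, sub_add_cancel]
    rw [← hfx, hsum]
    have h1 : (inner ℝ (f - π J) x) ^ 2 ≤ (t J) ^ 2 * ‖x‖ ^ 2 := by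
      rw [← mul_pow, ← sq_abs]
      have h2 : ‖f - π J‖ ≤ t J := hπ J
      have := abs_real_inner_le_norm (f - π J) x
      gcongr
      exact this.trans (by gcongr)
    have h2 : (∑ j ∈ Finset.range J, inner ℝ (π (j + 1) - π j) x) ^ 2 ≤ J * ∑ j ∈ Finset.range J, F j x := by
      refine sq_sum_le_card_mul_sum_sq.trans ?_
      rw [Finset.card_range]
      gcongr with j _
      exact hlink j
    set a := inner ℝ (f - π J) x
    set b := ∑ j ∈ Finset.range J, inner ℝ (π (j + 1) - π j) x
    nlinarith [sq_nonneg (a - b)]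
  rw [ellNormSq_eq]
  have hi1 : Integrable (fun x => 2 * (t J) ^ 2 * ‖x‖ ^ 2) (stdGaussian (EuclideanSpace ℝ (Fin n))) :=
    (sq_norm_std n).1.const_mul _
  have hi2 : Integrable (fun x => 2 * J * ∑ j ∈ Finset.range J, F j x) (stdGaussian (EuclideanSpace ℝ (Fin n))) :=
    (integrable_finsetSum _ fun j _ => hFi j).const_mul _
  refine (integral_mono_of_nonneg (ae_of_all _ fun x => by positivity) (hi1.add hi2) (ae_of_all _ hpt)).trans ?_
  change ∫ x, (2 * (t J) ^ 2 * ‖x‖ ^ 2 + 2 * J * ∑ j ∈ Finset.range J, F j x) ∂_ ≤ _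
  rw [integral_add hi1 hi2, integral_const_mul, integral_const_mul, (sq_norm_std n).2,
    integral_finsetSum _ fun j _ => hFi j]
  have : ∑ j ∈ Finset.range J, ∫ x, F j x ∂(stdGaussian (EuclideanSpace ℝ (Fin n))) ≤
      J * (57600 * α ^ 2 * n * Λ) := by
    refine (Finset.sum_le_sum fun j _ => hFint' j).trans ?_
    rw [Finset.sum_const, Finset.card_range, nsmul_eq_mul]
  gcongr

open ProbabilityTheory in
lemma one_le_norm {X : Type*} [NormedAddCommGroup X] [NormedSpace ℝ X]
    {n : ℕ} (hn : 0 < n) (T : EuclideanSpace ℝ (Fin n) →L[ℝ] X) (h : (n : ℝ) ≤ ellNormSq T) :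
    1 ≤ ‖T‖ := by
  have h1 : ellNormSq T ≤ ‖T‖ ^ 2 * n := by
    rw [ellNormSq_eq, ← (sq_norm_std n).2, ← integral_const_mul]
    refine integral_mono_of_nonneg (ae_of_all _ fun x => by positivity) ((sq_norm_std n).1.const_mul _)
      (ae_of_all _ fun x => ?_)
    change ‖T x‖ ^ 2 ≤ ‖T‖ ^ 2 * ‖x‖ ^ 2
    rw [← mul_pow]
    gcongr
    exact T.le_opNorm x
  have hnR : (0 : ℝ) < n := by exact_mod_cast hn
  by_contra! hc
  have : ‖T‖ ^ 2 < 1 := by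
    have := norm_nonneg T
    nlinarith
  nlinarith

/-- numerical conclusion -/
lemma numerics (M c α : ℝ) (hM : 1 ≤ M) (hc : c = 1 / 10 ^ 9)
    (hα : α = c * (Real.log (2 * M)) ^ (-(3 / 2) : ℝ)) :
    0 < α ∧ α ≤ 1 ∧ ∃ J : ℕ, 2 * (M / 2 ^ J) ^ 2 ≤ 1 / 2 ∧
      2 * J * (J * (57600 * α ^ 2 * (6 * Real.log (M / α) + 3))) < 1 / 2 := by
  set L := Real.log (2 * M) with hL
  have hlog2 : 0.69 < Real.log 2 := by have := Real.log_two_gt_d9; linarith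
  have hL2 : Real.log 2 ≤ L := Real.log_le_log (by norm_num) (by linarith)
  have hL0 : 0 < L := by linarith
  have hc0 : 0 < c := by rw [hc]; norm_num
  have hα0 : 0 < α := by rw [hα]; positivity
  have hα2 : α ^ 2 * L ^ 3 = c ^ 2 := by
    rw [hα, mul_pow, ← Real.rpow_natCast (L ^ (-(3 / 2) : ℝ)) 2, ← Real.rpow_mul hL0.le]
    have : L ^ (-(3 / 2) * ((2 : ℕ) : ℝ) : ℝ) = (L ^ 3)⁻¹ := by
      rw [← Real.rpow_natCast L 3, ← Real.rpow_neg hL0.le]; norm_num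
    rw [this]
    field_simp
  have hL3 : (0.3 : ℝ) ≤ L ^ 3 := by
    calc (0.3 : ℝ) ≤ 0.69 ^ 3 := by norm_num
      _ ≤ L ^ 3 := by gcongr; linarith
  have hα1 : α ≤ 1 := by
    by_contra! h
    have h1 : 1 < α ^ 2 := by nlinarith
    have h2 : c ^ 2 ≤ 0.1 := by rw [hc]; norm_num
    nlinarith
  have hlogα : Real.log (M / α) ≤ 5 / 2 * L + 1 / c := by
    have e : Real.log (M / α) = Real.log M - Real.log c + 3 / 2 * Real.log L := by
      rw [Real.log_div (by linarith) hα0.ne', hα, Real.log_mul hc0.ne' (by positivity), Real.log_rpow hL0]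
      ring
    have h1 : Real.log M ≤ L := Real.log_le_log (by linarith) (by linarith)
    have h2 : - Real.log c ≤ 1 / c := by
      rw [← Real.log_inv, one_div]
      have := Real.log_le_sub_one_of_pos (inv_pos.2 hc0)
      linarith
    have h3 := Real.log_le_sub_one_of_pos hL0
    rw [e]
    linarith
  refine ⟨hα0, hα1, ⌈Real.logb 2 (2 * M)⌉₊, ?_, ?_⟩
  · set J := ⌈Real.logb 2 (2 * M)⌉₊
    have h1 : 2 * M ≤ 2 ^ J := by
      have : Real.logb 2 (2 * M) ≤ J := Nat.le_ceil _
      rw [Real.logb_le_iff_le_rpow (by norm_num) (by linarith)] at this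
      exact_mod_cast this
    have h2 : M / 2 ^ J ≤ 1 / 2 := by rw [div_le_iff₀ (by positivity)]; linarith
    have h3 : 0 ≤ M / 2 ^ J := by positivity
    nlinarith
  · set J := ⌈Real.logb 2 (2 * M)⌉₊
    have hJ : (J : ℝ) ≤ 3 * L := by
      have h1 : (J : ℝ) < Real.logb 2 (2 * M) + 1 := Nat.ceil_lt_add_one (by
        apply Real.logb_nonneg (by norm_num); linarith)
      have h2 : Real.logb 2 (2 * M) = L / Real.log 2 := rfl
      have h3 : L / Real.log 2 ≤ L / 0.69 := by gcongr
      have h4 : L / 0.69 ≤ 1.45 * L := by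
        rw [div_le_iff₀ (by norm_num)]; linarith
      rw [h2] at h1
      linarith
    have hlogM0 : 0 ≤ Real.log (M / α) := Real.log_nonneg (by rw [le_div_iff₀ hα0]; linarith)
    have hJ0 : (0 : ℝ) ≤ J := Nat.cast_nonneg _
    have hb : 6 * Real.log (M / α) + 3 ≤ (20 + 9 / c) * L := by
      have : 6 * (1 / c) ≤ 9 / c * L := by
        rw [div_mul_eq_mul_div, mul_one_div, div_le_div_iff_of_pos_right hc0]; linarith
      nlinarith
    calc 2 * (J : ℝ) * (J * (57600 * α ^ 2 * (6 * Real.log (M / α) + 3)))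
        ≤ 2 * (3 * L) * ((3 * L) * (57600 * α ^ 2 * ((20 + 9 / c) * L))) := by gcongr
      _ = 1036800 * (α ^ 2 * L ^ 3) * (20 + 9 / c) := by ring
      _ < 1 / 2 := by rw [hα2, hc]; norm_num

/-- General principle of restricted invertibility. Let `T : ℓ₂^n → X` be
a linear operator into a Banach space with `ℓ(T) ≥ √n`, and `α = c·(log(2‖T‖))^{-3/2}`.
Then there is `σ ⊆ {1,…,n}` with `|σ| ≥ c·α²·n/‖T‖²` such that
`‖Tx‖ ≥ α·|σ|^{-1/2}·‖x‖_{ℓ₁^σ}` for all `x ∈ ℝ^σ`. -/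
theorem general_restricted_invertibility :
    ∃ c > (0 : ℝ), ∀ (n : ℕ) (X : Type) [inst1 : NormedAddCommGroup X]
      [inst2 : NormedSpace ℝ X] [inst3 : CompleteSpace X],
      ∀ T : EuclideanSpace ℝ (Fin n) →L[ℝ] X,
      (n : ℝ) ≤ ellNormSq T →
      ∀ α : ℝ, α = c * (Real.log (2 * ‖T‖)) ^ (-(3 / 2) : ℝ) →
      ∃ s : Finset (Fin n), c * α ^ 2 * n / ‖T‖ ^ 2 ≤ s.card ∧
        ∀ x : EuclideanSpace ℝ (Fin n), (∀ i ∉ s, x i = 0) →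
          α * ((s.card : ℝ) ^ (-(1 / 2) : ℝ)) * ∑ i ∈ s, |x i| ≤ ‖T x‖ := by
  refine ⟨1 / 10 ^ 9, by norm_num, ?_⟩
  intro n X _ _ _ T hT α hα
  rcases Nat.eq_zero_or_pos n with h0 | hn
  · refine ⟨∅, by simp [h0], ?_⟩
    intro x _
    simp
  · by_contra! H
    have hM := one_le_norm hn T hT
    obtain ⟨hα0, hα1, J, hJ1, hJ2⟩ := numerics ‖T‖ _ α hM rfl hα
    have hch := chain hn T _ α (by norm_num) hα0 hα1 hM H J
    have hnR : (0 : ℝ) < n := by exact_mod_cast hn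
    have h1 := mul_lt_mul_of_pos_right hJ2 hnR
    have h2 := mul_le_mul_of_nonneg_right hJ1 hnR.le
    nlinarith
end

section
/- Let X be a Banach space of type 2 and let T : ℓ₂^n → X be a linear operator with ℓ(T) ≥ √n. Let α = c·(log(2‖T‖))^{−3/2}. Then there exists a subset σ of {1,…,n} with |σ| ≥ α²·n/‖T‖² such that ‖Tx‖ ≥ α·T₂(X)^{−1}·‖x‖ for all x ∈ ℝ^σ, where c > 0 is an absolute constant, ‖x‖ is the ℓ₂ norm, and T₂(X) is the type 2 constant of X. -/
open MeasureTheory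
open scoped ENNReal NNReal

/-- `X` has type 2 with constant `M`: for all finite sequences `(xᵢ)` in `X`,
`𝔼‖Σ εᵢ xᵢ‖ ≤ M·(Σ‖xᵢ‖²)^{1/2}` where `εᵢ` are independent symmetric `±1` signs. -/
def IsType2With (X : Type*) [NormedAddCommGroup X] (M : ℝ) : Prop :=
  ∀ (m : ℕ) (x : Fin m → X),
    (∑ ε : Fin m → Bool, ‖∑ i, (if ε i then x i else -x i)‖) / 2 ^ m ≤
      M * Real.sqrt (∑ i, ‖x i‖ ^ 2)

/-- The type 2 constant `T₂(X)`: the least `M` such that `X` has type 2 with constant `M`. -/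
noncomputable def type2Const (X : Type*) [NormedAddCommGroup X] : ℝ :=
  sInf {M : ℝ | 0 ≤ M ∧ IsType2With X M}

section
open Matrix

lemma ri_cs {ι : Type*} [Fintype ι] {A : Matrix ι ι ℝ} (hA : A.PosSemidef) (x y : ι → ℝ) :
    (x ⬝ᵥ A *ᵥ y) ^ 2 ≤ (x ⬝ᵥ A *ᵥ x) * (y ⬝ᵥ A *ᵥ y) := by
  have hs : y ⬝ᵥ A *ᵥ x = x ⬝ᵥ A *ᵥ y := by
    have : Aᵀ = A := (by simpa using hA.1 : A.IsSymm)
    rw [dotProduct_mulVec, ← mulVec_transpose, this, dotProduct_comm]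
  have h : ∀ t : ℝ, 0 ≤ (y ⬝ᵥ A *ᵥ y) * (t * t) + (2 * (x ⬝ᵥ A *ᵥ y)) * t + (x ⬝ᵥ A *ᵥ x) := by
    intro t
    have := hA.dotProduct_mulVec_nonneg (x + t • y)
    simp only [star_trivial, mulVec_add, mulVec_smul, dotProduct_add, add_dotProduct,
      smul_dotProduct, dotProduct_smul, smul_eq_mul, hs] at this
    linarith
  have := discrim_le_zero h
  unfold discrim at this
  nlinarith

lemma ri_barrier_step {ι κ : Type*} [Fintype ι] [DecidableEq ι] [Fintype κ] [DecidableEq κ]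
    (M : Matrix ι ι ℝ) (hM : M.PosDef) (r : κ → ι → ℝ)
    (hr : ∀ v : ι → ℝ, ∑ i, (r i ⬝ᵥ v) ^ 2 ≤ v ⬝ᵥ v) (δ : ℝ) (hδ : 0 < δ) (τ : Finset κ)
    (hτ : τ.card + 2 * (∑ i, r i ⬝ᵥ M⁻¹ *ᵥ r i) + 2 / δ < Fintype.card κ) :
    ∃ i ∉ τ, (M + δ • (1 : Matrix ι ι ℝ) - vecMulVec (r i) (r i)).PosDef ∧
      ∑ l, r l ⬝ᵥ (M + δ • (1 : Matrix ι ι ℝ) - vecMulVec (r i) (r i))⁻¹ *ᵥ r l ≤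
        ∑ l, r l ⬝ᵥ M⁻¹ *ᵥ r l := by
  set M' := M + δ • (1 : Matrix ι ι ℝ) with hM'
  have hM'p : M'.PosDef := hM.add_posSemidef (Matrix.PosSemidef.one.smul hδ.le)
  set B := M'⁻¹ with hB
  have hBp : B.PosDef := hM'p.inv
  have hMB : ∀ v, M' *ᵥ (B *ᵥ v) = v := by
    intro v
    rw [mulVec_mulVec, hB, mul_nonsing_inv _ ((isUnit_iff_isUnit_det _).1 hM'p.isUnit), one_mulVec]
  have hMM : ∀ v, M⁻¹ *ᵥ (M *ᵥ v) = v := by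
    intro v
    rw [mulVec_mulVec, nonsing_inv_mul _ ((isUnit_iff_isUnit_det _).1 hM.isUnit), one_mulVec]
  have symm : ∀ {A : Matrix ι ι ℝ}, A.PosDef → ∀ x y, x ⬝ᵥ A *ᵥ y = y ⬝ᵥ A *ᵥ x := by
    intro A hA x y
    have : Aᵀ = A := (by simpa using hA.1 : A.IsSymm)
    rw [dotProduct_mulVec, ← mulVec_transpose, this, dotProduct_comm]
  have nn : ∀ {A : Matrix ι ι ℝ}, A.PosDef → ∀ x, 0 ≤ x ⬝ᵥ A *ᵥ x := by
    intro A hA x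
    simpa using hA.posSemidef.dotProduct_mulVec_nonneg x
  -- resolvent inequality
  have hres : ∀ v, v ⬝ᵥ B *ᵥ v + δ * (B *ᵥ v ⬝ᵥ B *ᵥ v) ≤ v ⬝ᵥ M⁻¹ *ᵥ v := by
    intro v
    set w := B *ᵥ v with hw
    have hv : v = M *ᵥ w + δ • w := by
      have := hMB v
      rw [← hw, hM', add_mulVec, smul_mulVec, one_mulVec] at this
      exact this.symm
    have e1 : M⁻¹ *ᵥ v = w + δ • M⁻¹ *ᵥ w := by
      rw [hv, mulVec_add, hMM, mulVec_smul]
    rw [e1]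
    have e2 : (M *ᵥ w) ⬝ᵥ (M⁻¹ *ᵥ w) = w ⬝ᵥ w := by
      rw [symm hM.inv, hMM]
    have e3 := nn hM.inv w
    rw [dotProduct_add, dotProduct_smul, smul_eq_mul]
    have e4 : v ⬝ᵥ M⁻¹ *ᵥ w = w ⬝ᵥ w + δ * (w ⬝ᵥ M⁻¹ *ᵥ w) := by
      conv_lhs => rw [hv]
      rw [add_dotProduct, e2, smul_dotProduct, smul_eq_mul]
    rw [e4]
    have : 0 ≤ δ * (δ * (w ⬝ᵥ M⁻¹ *ᵥ w)) := by positivity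
    linarith
  set q : κ → ℝ := fun i => r i ⬝ᵥ B *ᵥ r i with hq
  set p : κ → ℝ := fun i => ∑ l, (r l ⬝ᵥ B *ᵥ r i) ^ 2 with hp
  set Ψ : ℝ := ∑ i, (B *ᵥ r i ⬝ᵥ B *ᵥ r i) with hΨ
  set Φ : ℝ := ∑ l, r l ⬝ᵥ M⁻¹ *ᵥ r l with hΦ
  have hpΨ : ∑ i, p i ≤ Ψ := Finset.sum_le_sum fun i _ => hr _
  have hΨ0 : 0 ≤ Ψ := Finset.sum_nonneg fun i _ => by
    simp only [dotProduct]; exact Finset.sum_nonneg fun j _ => mul_self_nonneg _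
  have hq0 : ∀ i, 0 ≤ q i := fun i => nn hBp _
  have hp0 : ∀ i, 0 ≤ p i := fun i => Finset.sum_nonneg fun j _ => sq_nonneg _
  have hsum : ∑ i, q i + δ * Ψ ≤ Φ := by
    rw [hΨ, Finset.mul_sum, ← Finset.sum_add_distrib]
    exact Finset.sum_le_sum fun i _ => hres _
  obtain ⟨i, hiτ, hqi, hpi⟩ : ∃ i ∉ τ, q i ≤ 1 / 2 ∧ p i ≤ δ * Ψ / 2 := by
    by_contra hcon
    push Not at hcon
    set S1 := Finset.univ.filter fun i => 1 / 2 < q i with hS1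
    set S2 := Finset.univ.filter fun i => δ * Ψ / 2 < p i with hS2
    have hcov : (Finset.univ : Finset κ) ⊆ τ ∪ (S1 ∪ S2) := by
      intro i _
      simp only [Finset.mem_union, hS1, hS2, Finset.mem_filter, Finset.mem_univ, true_and]
      by_cases h1 : i ∈ τ
      · exact Or.inl h1
      · by_cases h2 : q i ≤ 1 / 2
        · exact Or.inr (Or.inr (hcon i h1 h2))
        · exact Or.inr (Or.inl (not_le.1 h2))
    have hc : (Fintype.card κ : ℝ) ≤ τ.card + (S1.card + S2.card) := by
      have h1 := Finset.card_le_card hcov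
      have h2 := Finset.card_union_le τ (S1 ∪ S2)
      have h3 := Finset.card_union_le S1 S2
      rw [Finset.card_univ] at h1
      exact_mod_cast h1.trans (h2.trans (by omega))
    have h1 : (S1.card : ℝ) * (1 / 2) ≤ ∑ i, q i := by
      calc (S1.card : ℝ) * (1 / 2) = ∑ i ∈ S1, (1 / 2 : ℝ) := by simp
        _ ≤ ∑ i ∈ S1, q i := Finset.sum_le_sum fun i hi => (Finset.mem_filter.1 hi).2.le
        _ ≤ ∑ i, q i := Finset.sum_le_sum_of_subset_of_nonneg (Finset.subset_univ _)
            fun i _ _ => hq0 i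
    have h2 : (S2.card : ℝ) ≤ 2 / δ := by
      by_cases hS : S2 = ∅
      · rw [hS]; simp; positivity
      obtain ⟨i0, hi0⟩ := Finset.nonempty_iff_ne_empty.2 hS
      have h3 : (S2.card : ℝ) * (δ * Ψ / 2) ≤ ∑ i, p i := by
        calc (S2.card : ℝ) * (δ * Ψ / 2) = ∑ i ∈ S2, (δ * Ψ / 2 : ℝ) := by simp
          _ ≤ ∑ i ∈ S2, p i := Finset.sum_le_sum fun i hi => (Finset.mem_filter.1 hi).2.le
          _ ≤ ∑ i, p i := Finset.sum_le_sum_of_subset_of_nonneg (Finset.subset_univ _)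
              fun i _ _ => hp0 i
      have hΨpos : 0 < Ψ := by
        rcases hΨ0.lt_or_eq with h | h
        · exact h
        · exfalso
          have h4 := (Finset.mem_filter.1 hi0).2
          have h5 : p i0 ≤ ∑ i, p i := Finset.single_le_sum (fun i _ => hp0 i) (Finset.mem_univ i0)
          rw [← h] at h4 hpΨ
          linarith
      rw [le_div_iff₀ hδ]
      have h6 : (S2.card : ℝ) * δ * Ψ ≤ 2 * Ψ := by linarith
      exact le_of_mul_le_mul_right h6 hΨpos
    have : 0 ≤ δ * Ψ := by positivity
    linarith
  refine ⟨i, hiτ, ?_, ?_⟩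
  · refine Matrix.PosDef.of_dotProduct_mulVec_pos ?_ ?_
    · refine hM'p.1.sub ?_
      ext a b
      simp [vecMulVec_apply, mul_comm]
    · intro v hv
      have h1 : 0 < v ⬝ᵥ M' *ᵥ v := by simpa using hM'p.dotProduct_mulVec_pos hv
      have h2 := ri_cs hM'p.posSemidef (B *ᵥ r i) v
      have h3 : B *ᵥ r i ⬝ᵥ M' *ᵥ v = r i ⬝ᵥ v := by
        rw [symm hM'p, hMB, dotProduct_comm]
      have h4 : B *ᵥ r i ⬝ᵥ M' *ᵥ (B *ᵥ r i) = q i := by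
        rw [hMB, dotProduct_comm]
      rw [h3, h4] at h2
      have h5 : v ⬝ᵥ vecMulVec (r i) (r i) *ᵥ v = (r i ⬝ᵥ v) ^ 2 := by
        rw [vecMulVec_mulVec]
        simp [dotProduct_comm v, sq]
      rw [star_trivial, sub_mulVec, dotProduct_sub, h5]
      nlinarith
  · set M2 := M' - vecMulVec (r i) (r i) with hM2
    have hq1 : 0 < 1 - q i := by linarith
    have hinv : ∀ v, M2⁻¹ *ᵥ v = B *ᵥ v + ((r i ⬝ᵥ B *ᵥ v) / (1 - q i)) • B *ᵥ r i := by
      intro v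
      have hMi : M2⁻¹ = B + (1 / (1 - q i)) • vecMulVec (B *ᵥ r i) (B *ᵥ r i) := by
        apply Matrix.inv_eq_right_inv
        apply Matrix.ext_of_mulVec_single
        intro j
        set u : ι → ℝ := Pi.single j 1
        have h1 : B *ᵥ r i ⬝ᵥ u = r i ⬝ᵥ B *ᵥ u := by
          rw [symm hBp, dotProduct_comm]
        rw [← mulVec_mulVec, add_mulVec, smul_mulVec, vecMulVec_mulVec, h1, hM2, sub_mulVec,
          mulVec_add, hMB, mulVec_smul, one_mulVec, vecMulVec_mulVec]
        simp only [op_smul_eq_smul, dotProduct_add, dotProduct_smul, mulVec_smul, hMB,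
          smul_eq_mul]
        change _ - (_ + 1 / (1 - q i) * (_ * q i)) • _ = _
        ext k
        simp only [Pi.sub_apply, Pi.add_apply, Pi.smul_apply, smul_eq_mul]
        field_simp
        ring
      rw [hMi, add_mulVec, smul_mulVec, vecMulVec_mulVec]
      have h1 : B *ᵥ r i ⬝ᵥ v = r i ⬝ᵥ B *ᵥ v := by
        rw [symm hBp, dotProduct_comm]
      rw [h1, op_smul_eq_smul, smul_smul]
      congr 2
      ring
    have hl : ∀ l, r l ⬝ᵥ M2⁻¹ *ᵥ r l = q l + (r l ⬝ᵥ B *ᵥ r i) ^ 2 / (1 - q i) := by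
      intro l
      rw [hinv, dotProduct_add, dotProduct_smul, symm hBp (r i) (r l), smul_eq_mul]
      ring
    rw [Finset.sum_congr rfl fun l _ => hl l, Finset.sum_add_distrib, ← Finset.sum_div]
    have : p i / (1 - q i) ≤ δ * Ψ := by
      rw [div_le_iff₀ hq1]
      have : 0 ≤ δ * Ψ := by positivity
      nlinarith
    change ∑ l, q l + p i / (1 - q i) ≤ Φ
    linarith

lemma ri_barrier {ι κ : Type*} [Fintype ι] [DecidableEq ι] [Fintype κ] [DecidableEq κ]
    (r : κ → ι → ℝ) (hr : ∀ v : ι → ℝ, ∑ i, (r i ⬝ᵥ v) ^ 2 ≤ v ⬝ᵥ v)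
    (hd : ∑ i, r i ⬝ᵥ r i ≤ (Fintype.card κ : ℝ) / 64) (hm : 0 < Fintype.card κ) (s : ℕ)
    (hs : 32 * s ≤ Fintype.card κ) :
    ∃ τ : Finset κ, τ.card = s ∧ ∀ v : ι → ℝ, ∑ i ∈ τ, (r i ⬝ᵥ v) ^ 2 ≤ (1 / 2) * (v ⬝ᵥ v) := by
  set m : ℝ := (Fintype.card κ : ℝ) with hmdef
  have hm0 : 0 < m := by rw [hmdef]; exact_mod_cast hm
  suffices h : ∀ s : ℕ, 32 * s ≤ Fintype.card κ → ∃ τ : Finset κ, τ.card = s ∧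
      ∃ M : Matrix ι ι ℝ, M.PosDef ∧ ∑ l, r l ⬝ᵥ M⁻¹ *ᵥ r l ≤ m / 16 ∧
      ∀ v : ι → ℝ, v ⬝ᵥ M *ᵥ v = (1 / 4 + 8 * s / m) * (v ⬝ᵥ v) - ∑ i ∈ τ, (r i ⬝ᵥ v) ^ 2 by
    obtain ⟨τ, h1, M, hM, -, h3⟩ := h s hs
    refine ⟨τ, h1, fun v => ?_⟩
    have h4 : 0 ≤ v ⬝ᵥ M *ᵥ v := by simpa using hM.posSemidef.dotProduct_mulVec_nonneg v
    rw [h3] at h4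
    have h5 : (8 * s / m : ℝ) ≤ 1 / 4 := by
      rw [div_le_iff₀ hm0]
      have : (32 * s : ℝ) ≤ m := by rw [hmdef]; exact_mod_cast hs
      linarith
    have h6 : 0 ≤ v ⬝ᵥ v := by
      simp only [dotProduct]; exact Finset.sum_nonneg fun j _ => mul_self_nonneg _
    nlinarith
  intro s
  induction s with
  | zero =>
    intro _
    refine ⟨∅, rfl, (1 / 4 : ℝ) • 1, Matrix.PosDef.one.smul (by norm_num), ?_, ?_⟩
    · have : ((1 / 4 : ℝ) • (1 : Matrix ι ι ℝ))⁻¹ = (4 : ℝ) • 1 := by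
        apply Matrix.inv_eq_right_inv
        simp [smul_smul]
      rw [this]
      simp only [smul_mulVec, one_mulVec, dotProduct_smul, smul_eq_mul, ← Finset.mul_sum]
      linarith
    · intro v
      simp [smul_mulVec]
  | succ s ih =>
    intro hs
    obtain ⟨τ, h1, M, hM, h2, h3⟩ := ih (by omega)
    have hs' : (32 * (s + 1) : ℝ) ≤ m := by rw [hmdef]; exact_mod_cast hs
    obtain ⟨i, hi, h4, h5⟩ := ri_barrier_step M hM r hr (8 / m) (by positivity) τ (by
      rw [h1, ← hmdef]
      have : (2 / (8 / m) : ℝ) = m / 4 := by field_simp; norm_num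
      rw [this]
      linarith)
    refine ⟨insert i τ, by rw [Finset.card_insert_of_notMem hi, h1], _, h4, h5.trans h2, ?_⟩
    intro v
    have h6 : v ⬝ᵥ vecMulVec (r i) (r i) *ᵥ v = (r i ⬝ᵥ v) ^ 2 := by
      rw [vecMulVec_mulVec]
      simp [dotProduct_comm v, sq]
    rw [sub_mulVec, dotProduct_sub, h6, add_mulVec, dotProduct_add, h3, smul_mulVec, one_mulVec,
      dotProduct_smul, Finset.sum_insert hi, smul_eq_mul]
    push_cast
    ring

lemma ri_tr {ι κ : Type*} [Fintype ι] [Fintype κ] (C : Matrix ι κ ℝ) (v : ι → ℝ) (y : κ → ℝ) :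
    v ⬝ᵥ C *ᵥ y = Cᵀ *ᵥ v ⬝ᵥ y := by
  rw [dotProduct_mulVec, ← mulVec_transpose]

lemma ri_dot_nonneg {ι : Type*} [Fintype ι] (v : ι → ℝ) : 0 ≤ v ⬝ᵥ v := by
  simp only [dotProduct]; exact Finset.sum_nonneg fun j _ => mul_self_nonneg _

lemma ri_dot_cs {ι : Type*} [Fintype ι] (v w : ι → ℝ) : (v ⬝ᵥ w) ^ 2 ≤ (v ⬝ᵥ v) * (w ⬝ᵥ w) := by
  have := Finset.sum_mul_sq_le_sq_mul_sq Finset.univ v w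
  simpa [dotProduct, sq] using this

lemma ri_symm {ι : Type*} [Fintype ι] {A : Matrix ι ι ℝ} (hA : A.PosSemidef) (x y : ι → ℝ) :
    x ⬝ᵥ A *ᵥ y = y ⬝ᵥ A *ᵥ x := by
  have : Aᵀ = A := (by simpa using hA.1 : A.IsSymm)
  rw [dotProduct_mulVec, ← mulVec_transpose, this, dotProduct_comm]

lemma ri_nn {ι : Type*} [Fintype ι] {A : Matrix ι ι ℝ} (hA : A.PosSemidef) (x : ι → ℝ) :
    0 ≤ x ⬝ᵥ A *ᵥ x := by
  simpa using hA.dotProduct_mulVec_nonneg x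

lemma ri_flat {ι : Type*} [Fintype ι] [DecidableEq ι] [Nonempty ι] (G : Matrix ι ι ℝ)
    (hG : G.PosSemidef) (h : ∀ (x : ι → ℝ) i, (1 / 4) * x i ^ 2 ≤ x ⬝ᵥ G *ᵥ x) :
    ∃ τ : Finset ι, Fintype.card ι ≤ 64 * τ.card ∧
      ∀ x : ι → ℝ, (∀ i ∉ τ, x i = 0) → (1 / 512) * (x ⬝ᵥ x) ≤ x ⬝ᵥ G *ᵥ x := by
  by_cases hc : Fintype.card ι < 32
  · obtain ⟨i⟩ := ‹Nonempty ι›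
    refine ⟨{i}, by simp; omega, fun x hx => ?_⟩
    have : x ⬝ᵥ x = x i ^ 2 := by
      simp only [dotProduct]
      rw [Finset.sum_eq_single i]
      · ring
      · intro j _ hj; rw [hx j (by simpa using hj)]; ring
      · simp
    rw [this]
    have := h x i
    have := sq_nonneg (x i)
    linarith
  set K : Matrix ι ι ℝ := 1 + (256 : ℝ) • G with hK
  have hKp : K.PosDef := Matrix.PosDef.one.add_posSemidef (hG.smul (by norm_num))
  set R := K⁻¹ with hR
  have hRp : R.PosDef := hKp.inv
  have hKR : ∀ v, R *ᵥ v + (256 : ℝ) • G *ᵥ (R *ᵥ v) = v := by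
    intro v
    have : K *ᵥ (R *ᵥ v) = v := by
      rw [mulVec_mulVec, hR, mul_nonsing_inv _ ((isUnit_iff_isUnit_det _).1 hKp.isUnit), one_mulVec]
    rw [hK, add_mulVec, one_mulVec, smul_mulVec] at this
    exact this
  have hR1 : ∀ x, x ⬝ᵥ R *ᵥ x ≤ x ⬝ᵥ x := by
    intro x
    set w := R *ᵥ x with hw
    have hx : x = w + (256 : ℝ) • G *ᵥ w := (hKR x).symm
    rw [hx]
    simp only [add_dotProduct, dotProduct_add, smul_dotProduct, dotProduct_smul, smul_eq_mul]
    have h1 := ri_nn hG w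
    have h2 := ri_dot_nonneg (G *ᵥ w)
    have h3 : G *ᵥ w ⬝ᵥ w = w ⬝ᵥ G *ᵥ w := dotProduct_comm _ _
    rw [h3]
    linarith
  have hR2 : ∀ i, Pi.single i 1 ⬝ᵥ R *ᵥ Pi.single i 1 ≤ (1 / 64 : ℝ) := by
    intro i
    set x : ι → ℝ := Pi.single i 1 with hx0
    set w := R *ᵥ x with hw
    have hx : x = w + (256 : ℝ) • G *ᵥ w := (hKR x).symm
    have h1 : x ⬝ᵥ w = w i := by simp [hx0]
    have h2 : x ⬝ᵥ w = w ⬝ᵥ w + 256 * (w ⬝ᵥ G *ᵥ w) := by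
      conv_lhs => rw [hx]
      rw [add_dotProduct, smul_dotProduct, smul_eq_mul, dotProduct_comm (G *ᵥ w)]
    have h3 := h w i
    have h4 := ri_dot_nonneg w
    rw [h1] at h2 ⊢
    nlinarith
  have hR3 : ∀ x, x ⬝ᵥ x ≤ x ⬝ᵥ R *ᵥ x + 256 * (x ⬝ᵥ G *ᵥ x) := by
    intro x
    set w := R *ᵥ x with hw
    have hx : x = w + (256 : ℝ) • G *ᵥ w := (hKR x).symm
    set g := G *ᵥ w with hg
    have h1 : x ⬝ᵥ x = x ⬝ᵥ w + 256 * (x ⬝ᵥ g) := by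
      conv_lhs => rw [hx]
      conv_rhs => rw [hx]
      simp only [add_dotProduct, dotProduct_add, smul_dotProduct, dotProduct_smul, smul_eq_mul]
    have h2 : x ⬝ᵥ G *ᵥ x = x ⬝ᵥ g + 256 * (x ⬝ᵥ G *ᵥ g) := by
      have : G *ᵥ x = g + (256 : ℝ) • G *ᵥ g := by
        conv_lhs => rw [hx]
        rw [mulVec_add, mulVec_smul]
      rw [this, dotProduct_add, dotProduct_smul, smul_eq_mul]
    have h3 : x ⬝ᵥ G *ᵥ g = g ⬝ᵥ g + 256 * (g ⬝ᵥ G *ᵥ g) := by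
      conv_lhs => rw [hx]
      rw [add_dotProduct, smul_dotProduct, smul_eq_mul, ri_symm hG w g]
    have h4 := ri_dot_nonneg g
    have h5 := ri_nn hG g
    rw [h1, h2, h3]
    linarith
  obtain ⟨C, hC⟩ : ∃ C : Matrix ι ι ℝ, R = Cᵀ * C := by
    open scoped MatrixOrder in
    obtain ⟨C, hC⟩ := CStarAlgebra.nonneg_iff_eq_star_mul_self.1 hRp.posSemidef.nonneg
    exact ⟨C, by simpa [star_eq_conjTranspose] using hC⟩
  have hCx : ∀ x, x ⬝ᵥ R *ᵥ x = C *ᵥ x ⬝ᵥ C *ᵥ x := by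
    intro x
    rw [hC, ← mulVec_mulVec, dotProduct_mulVec, ← mulVec_transpose, transpose_transpose]
  set r : ι → ι → ℝ := fun i => C *ᵥ Pi.single i 1 with hr
  have hrv : ∀ i v, r i ⬝ᵥ v = (Cᵀ *ᵥ v) i := by
    intro i v
    simp [hr, dotProduct, mulVec]
  obtain ⟨τ, hτ1, hτ2⟩ := ri_barrier r (by
      intro v
      have e : ∑ i, (r i ⬝ᵥ v) ^ 2 = Cᵀ *ᵥ v ⬝ᵥ Cᵀ *ᵥ v := by
        simp only [hrv]; simp [dotProduct, sq]
      rw [e]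
      set y := Cᵀ *ᵥ v with hy
      have h1 : y ⬝ᵥ y = v ⬝ᵥ C *ᵥ y := by
        exact (ri_tr C v y).symm
      have h2 := ri_dot_cs v (C *ᵥ y)
      have h3 := hR1 y
      rw [hCx] at h3
      rw [← h1] at h2
      have h4 := ri_dot_nonneg v
      have h5 := ri_dot_nonneg y
      by_contra hcon
      push Not at hcon
      nlinarith) (by
      calc ∑ i, r i ⬝ᵥ r i ≤ ∑ i : ι, (1 / 64 : ℝ) := Finset.sum_le_sum fun i _ => by
            rw [← hCx]; exact hR2 i
        _ = _ := by simp; ring) Fintype.card_pos (Fintype.card ι / 32) (by omega)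
  refine ⟨τ, by omega, fun x hx => ?_⟩
  have h1 := hR3 x
  rw [hCx] at h1
  set y := C *ᵥ x with hy
  have h2 : y ⬝ᵥ y = ∑ i ∈ τ, x i * (r i ⬝ᵥ y) := by
    have : y ⬝ᵥ y = x ⬝ᵥ Cᵀ *ᵥ y := by
      rw [ri_tr Cᵀ x y, transpose_transpose]
    rw [this]
    simp only [hrv]
    rw [dotProduct]
    symm
    apply Finset.sum_subset (Finset.subset_univ _)
    intro i _ hi
    rw [hx i hi, zero_mul]
  have h3 := Finset.sum_mul_sq_le_sq_mul_sq τ x (fun i => r i ⬝ᵥ y)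
  rw [← h2] at h3
  have h4 := hτ2 y
  have h5 : ∑ i ∈ τ, x i ^ 2 = x ⬝ᵥ x := by
    simp only [dotProduct, ← sq]
    apply Finset.sum_subset (Finset.subset_univ _)
    intro i _ hi
    rw [hx i hi]; ring
  rw [h5] at h3
  have h6 := ri_dot_nonneg x
  have h7 := ri_dot_nonneg y
  have h8 : y ⬝ᵥ y ≤ (1 / 2) * (x ⬝ᵥ x) := by
    by_contra hcon
    push Not at hcon
    nlinarith
  linarith

lemma ri_det_block {ι : Type*} [Fintype ι] [DecidableEq ι] (H : Matrix ι ι ℝ) (hH : H.IsSymm) (i : ι)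
    (A : Matrix {l // l ≠ i} {l // l ≠ i} ℝ) (hA : A = H.submatrix Subtype.val Subtype.val)
    (hAp : A.PosDef) (b : {l // l ≠ i} → ℝ) (hb : b = fun l => H l.1 i) :
    H.det = A.det * (H i i - b ⬝ᵥ A⁻¹ *ᵥ b) := by
  have hAu : IsUnit A.det := (isUnit_iff_isUnit_det _).1 hAp.isUnit
  let : Invertible A := Matrix.invertibleOfIsUnitDet A hAu
  rw [Matrix.det_toBlock H (fun l => l ≠ i)]
  have h1 : toBlock H (fun l => l ≠ i) (fun l => l ≠ i) = A := by
    rw [hA]; rfl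
  rw [h1, det_fromBlocks₁₁]
  congr 1
  let : Unique {l // ¬ l ≠ i} := ⟨⟨⟨i, by simp⟩⟩, by rintro ⟨l, hl⟩; simpa using hl⟩
  rw [det_unique]
  have hd : (default : {l // ¬ l ≠ i}).1 = i := rfl
  simp only [Matrix.sub_apply, toBlock_apply, hd, mul_apply, invOf_eq_nonsing_inv]
  congr 1
  simp only [dotProduct, mulVec, hb, Finset.sum_mul, Finset.mul_sum]
  rw [Finset.sum_comm]
  refine Finset.sum_congr rfl fun x _ => Finset.sum_congr rfl fun y _ => ?_
  rw [hH.apply]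
  ring

lemma ri_quad_block {ι : Type*} [Fintype ι] [DecidableEq ι] (H : Matrix ι ι ℝ) (hH : H.IsSymm) (i : ι)
    (A : Matrix {l // l ≠ i} {l // l ≠ i} ℝ) (hA : A = H.submatrix Subtype.val Subtype.val)
    (hAp : A.PosDef) (b : {l // l ≠ i} → ℝ) (hb : b = fun l => H l.1 i) (x : ι → ℝ) :
    x i ^ 2 * (H i i - b ⬝ᵥ A⁻¹ *ᵥ b) ≤ x ⬝ᵥ H *ᵥ x := by
  set y : {l // l ≠ i} → ℝ := fun l => x l.1 with hy
  have hAA : A *ᵥ (A⁻¹ *ᵥ b) = b := by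
    rw [mulVec_mulVec, mul_nonsing_inv _ ((isUnit_iff_isUnit_det _).1 hAp.isUnit), one_mulVec]
  have h1 : x ⬝ᵥ H *ᵥ x = y ⬝ᵥ A *ᵥ y + 2 * x i * (b ⬝ᵥ y) + x i ^ 2 * H i i := by
    have e1 : ∀ l, (H *ᵥ x) l = H l i * x i + ∑ k : {l // l ≠ i}, H l k.1 * x k.1 := by
      intro l
      simp only [mulVec, dotProduct]
      exact Fintype.sum_eq_add_sum_subtype_ne _ i
    have e2 : x ⬝ᵥ H *ᵥ x = x i * (H *ᵥ x) i + ∑ k : {l // l ≠ i}, x k.1 * (H *ᵥ x) k.1 := by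
      simp only [dotProduct]
      exact Fintype.sum_eq_add_sum_subtype_ne _ i
    have e3 : ∑ k : {l // l ≠ i}, H i k.1 * x k.1 = b ⬝ᵥ y := by
      simp only [dotProduct, hb, hy]
      exact Finset.sum_congr rfl fun k _ => by rw [hH.apply]
    have e4 : ∑ k : {l // l ≠ i}, x k.1 * (H *ᵥ x) k.1 = x i * (b ⬝ᵥ y) + y ⬝ᵥ A *ᵥ y := by
      simp only [e1, mul_add, Finset.sum_add_distrib]
      simp only [dotProduct, mulVec, hb, hy, hA, submatrix_apply]
      congr 1
      rw [Finset.mul_sum]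
      exact Finset.sum_congr rfl fun k _ => by ring
    rw [e2, e4, e1, e3]
    ring
  have h2 := ri_nn hAp.posSemidef (y + x i • A⁻¹ *ᵥ b)
  rw [mulVec_add, mulVec_smul, hAA] at h2
  simp only [add_dotProduct, dotProduct_add, smul_dotProduct, dotProduct_smul, smul_eq_mul] at h2
  have h3 : A⁻¹ *ᵥ b ⬝ᵥ A *ᵥ y = b ⬝ᵥ y := by
    rw [ri_symm hAp.posSemidef, hAA, dotProduct_comm]
  have h4 : A⁻¹ *ᵥ b ⬝ᵥ b = b ⬝ᵥ A⁻¹ *ᵥ b := dotProduct_comm _ _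
  rw [h3, h4, dotProduct_comm y b] at h2
  rw [h1]
  linarith

lemma ri_trace_bound {ι : Type*} [Fintype ι] [DecidableEq ι] {n : ℕ} (W : Matrix (Fin n) (Fin n) ℝ)
    (hW : W.PosDef) (κ : ℝ) (hκ : ∀ v : Fin n → ℝ, v ⬝ᵥ W *ᵥ v ≤ κ * (v ⬝ᵥ v))
    (g : ι → Fin n) (A : Matrix ι ι ℝ) (hA : A = W.submatrix g g) (hAp : A.PosDef) :
    ∑ j, (fun l => W (g l) j) ⬝ᵥ A⁻¹ *ᵥ (fun l => W (g l) j) ≤ κ * Fintype.card ι := by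
  have hWs : W.IsSymm := by simpa using hW.1
  have hpsd : (κ • W - W * W).PosSemidef := by
    refine Matrix.PosSemidef.of_dotProduct_mulVec_nonneg ?_ ?_
    · have : (κ • W - W * W).IsSymm := by
        unfold Matrix.IsSymm
        rw [transpose_sub, transpose_smul, transpose_mul, hWs.eq]
      simpa using this
    · intro v
      rw [star_trivial, sub_mulVec, dotProduct_sub, smul_mulVec, dotProduct_smul, smul_eq_mul,
        ← mulVec_mulVec, ri_tr W v (W *ᵥ v), hWs.eq]
      have h1 := ri_cs hW.posSemidef (W *ᵥ v) v
      have h2 := hκ (W *ᵥ v)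
      have h3 := ri_nn hW.posSemidef v
      have h4 := ri_dot_nonneg (W *ᵥ v)
      rcases h4.lt_or_eq with h | h
      · have h5 : ((W *ᵥ v) ⬝ᵥ (W *ᵥ v)) * ((W *ᵥ v) ⬝ᵥ (W *ᵥ v)) ≤
            ((W *ᵥ v) ⬝ᵥ (W *ᵥ v)) * (κ * (v ⬝ᵥ W *ᵥ v)) := by nlinarith
        have := le_of_mul_le_mul_left h5 h
        linarith
      · have h6 : W *ᵥ v = 0 := dotProduct_self_eq_zero.1 h.symm
        simp [h6]
  have hsub := hpsd.submatrix g
  set Q : Matrix ι (Fin n) ℝ := W.submatrix g id with hQ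
  have hQQ : (κ • W - W * W).submatrix g g = κ • A - Q * Qᵀ := by
    ext a b
    simp only [submatrix_apply, Matrix.sub_apply, Matrix.smul_apply, mul_apply, hA, hQ, transpose_apply, id]
    congr 1
    exact Finset.sum_congr rfl fun k _ => by rw [hWs.apply (g b) k]
  rw [hQQ] at hsub
  obtain ⟨D, hD⟩ : ∃ D : Matrix ι ι ℝ, A⁻¹ = Dᵀ * D := by
    open scoped MatrixOrder in
    obtain ⟨C, hC⟩ := CStarAlgebra.nonneg_iff_eq_star_mul_self.1 hAp.inv.posSemidef.nonneg
    exact ⟨C, by simpa [star_eq_conjTranspose] using hC⟩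
  have h1 := (hsub.mul_mul_conjTranspose_same D).trace_nonneg
  have h2 : (D * (κ • A - Q * Qᵀ) * Dᴴ).trace = κ * Fintype.card ι - (Qᵀ * A⁻¹ * Q).trace := by
    have e : (D * (κ • A - Q * Qᵀ) * Dᴴ).trace = (A⁻¹ * (κ • A - Q * Qᵀ)).trace := by
      rw [hD, Matrix.trace_mul_comm, ← Matrix.mul_assoc]; simp
    rw [e, Matrix.mul_sub, trace_sub, Matrix.mul_smul,
      nonsing_inv_mul _ ((isUnit_iff_isUnit_det _).1 hAp.isUnit), trace_smul, trace_one, smul_eq_mul]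
    congr 1
    rw [← Matrix.mul_assoc, Matrix.trace_mul_comm, Matrix.mul_assoc]
  have h3 : (Qᵀ * A⁻¹ * Q).trace =
      ∑ j, (fun l => W (g l) j) ⬝ᵥ A⁻¹ *ᵥ (fun l => W (g l) j) := by
    rw [Matrix.mul_assoc]
    simp only [trace, diag, mul_apply, dotProduct, mulVec]
    rfl
  rw [h2, h3] at h1
  linarith

lemma ri_maxdet {n : ℕ} (W : Matrix (Fin n) (Fin n) ℝ)
    (hW : W.PosDef) (κ : ℝ) (hκ : ∀ v : Fin n → ℝ, v ⬝ᵥ W *ᵥ v ≤ κ * (v ⬝ᵥ v))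
    (htr : (n : ℝ) ≤ W.trace) (r : ℕ) (hr : κ * r ≤ 3 * n / 4) (hrn : r + 1 ≤ n) :
    ∃ f : Fin (r + 1) → Fin n, Function.Injective f ∧
      ∀ (x : Fin (r + 1) → ℝ) i, (1 / 4) * x i ^ 2 ≤ x ⬝ᵥ (W.submatrix f f) *ᵥ x := by
  have hWs : W.IsSymm := by simpa using hW.1
  have : Nonempty (Fin n) := ⟨⟨0, by omega⟩⟩
  obtain ⟨f, hf⟩ := Finite.exists_max (fun f : Fin (r + 1) → Fin n => (W.submatrix f f).det)
  have hpos : 0 < (W.submatrix f f).det :=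
    lt_of_lt_of_le (hW.submatrix (Fin.castLE_injective hrn)).det_pos (hf (Fin.castLE hrn))
  have hinj : Function.Injective f := by
    intro a b hab
    by_contra hne
    have : (W.submatrix f f).det = 0 := Matrix.det_zero_of_row_eq hne (by
      ext k; simp [hab])
    linarith
  refine ⟨f, hinj, fun x i => ?_⟩
  set A : Matrix {l // l ≠ i} {l // l ≠ i} ℝ :=
    W.submatrix (fun l => f l.1) (fun l => f l.1) with hA
  have hAp : A.PosDef := hW.submatrix (hinj.comp Subtype.val_injective)
  set S : Fin n → ℝ := fun j => W j j - (fun l : {l // l ≠ i} => W (f l.1) j) ⬝ᵥ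
    A⁻¹ *ᵥ (fun l : {l // l ≠ i} => W (f l.1) j) with hS
  have hdet : ∀ j, (W.submatrix (Function.update f i j) (Function.update f i j)).det
      = A.det * S j := by
    intro j
    rw [ri_det_block _ (hWs.submatrix _) i A ?_ hAp (fun l => W (f l.1) j) ?_]
    · simp [hS]
    · ext a b
      simp [hA, Function.update_of_ne a.2, Function.update_of_ne b.2]
    · ext a
      simp [Function.update_of_ne a.2]
  have hle : ∀ j, S j ≤ S (f i) := by
    intro j
    have h1 := hf (Function.update f i j)
    have h2 := hdet (f i)
    rw [Function.update_eq_self] at h2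
    simp only [hdet, h2] at h1
    exact le_of_mul_le_mul_left h1 hAp.det_pos
  have hsum : ∑ j, S j ≤ n * S (f i) := by
    calc ∑ j, S j ≤ ∑ j : Fin n, S (f i) := Finset.sum_le_sum fun j _ => hle j
      _ = _ := by simp
  have h3 := ri_trace_bound W hW κ hκ (fun l : {l // l ≠ i} => f l.1) A hA hAp
  have h4 : ∑ j, S j = W.trace - ∑ j, (fun l : {l // l ≠ i} => W (f l.1) j) ⬝ᵥ
    A⁻¹ *ᵥ (fun l : {l // l ≠ i} => W (f l.1) j) := by
    rw [hS, Finset.sum_sub_distrib]; rfl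
  have hcard : Fintype.card {l : Fin (r + 1) // l ≠ i} = r := by
    simp
  rw [hcard] at h3
  have hn : (0 : ℝ) < n := by
    have : 0 < n := by omega
    exact_mod_cast this
  have h5 : 1 / 4 ≤ S (f i) := by
    have : (n : ℝ) * (1 / 4) ≤ n * S (f i) := by linarith
    exact le_of_mul_le_mul_left this hn
  have h6 := ri_quad_block (W.submatrix f f) (hWs.submatrix _) i A (by rw [hA]; rfl) hAp
    (fun l => W (f l.1) (f i)) rfl x
  have h7 : x i ^ 2 * S (f i) ≤ x ⬝ᵥ (W.submatrix f f) *ᵥ x := h6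
  have := sq_nonneg (x i)
  nlinarith

lemma ri_select {n : ℕ} (hn : 0 < n) (Z : Matrix (Fin n) (Fin n) ℝ) (hZ : Z.PosSemidef) (L : ℝ)
    (hL : 1 / 2 ≤ L ^ 2) (hZL : ∀ v : Fin n → ℝ, v ⬝ᵥ Z *ᵥ v ≤ 2 * L ^ 2 * (v ⬝ᵥ v))
    (htr : (n : ℝ) ≤ Z.trace) :
    ∃ s : Finset (Fin n), (n : ℝ) / L ^ 2 ≤ 256 * s.card ∧
      ∀ x : Fin n → ℝ, (∀ i ∉ s, x i = 0) → (1 / 1024) * (x ⬝ᵥ x) ≤ x ⬝ᵥ Z *ᵥ x := by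
  set W : Matrix (Fin n) (Fin n) ℝ := Z + (1 / 1024 : ℝ) • 1 with hWdef
  have hW : W.PosDef := Matrix.PosDef.posSemidef_add hZ (Matrix.PosDef.one.smul (by norm_num))
  have hWZ : ∀ v, v ⬝ᵥ W *ᵥ v = v ⬝ᵥ Z *ᵥ v + (1 / 1024) * (v ⬝ᵥ v) := by
    intro v
    rw [hWdef, add_mulVec, dotProduct_add, smul_mulVec, one_mulVec, dotProduct_smul, smul_eq_mul]
  have hL0 : 0 < L ^ 2 := by linarith
  have hn' : (1 : ℝ) ≤ n := by exact_mod_cast hn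
  set r := ⌊(n : ℝ) / (4 * L ^ 2)⌋₊ with hr
  have hr1 : (r : ℝ) ≤ (n : ℝ) / (4 * L ^ 2) := Nat.floor_le (by positivity)
  have hr2 : (n : ℝ) / (4 * L ^ 2) < r + 1 := Nat.lt_floor_add_one _
  rw [le_div_iff₀ (by positivity)] at hr1
  rw [div_lt_iff₀ (by positivity)] at hr2
  have hr0 : (0 : ℝ) ≤ r := Nat.cast_nonneg _
  have hrn : r + 1 ≤ n := by
    have : (2 * r : ℝ) ≤ n := by nlinarith
    have : 2 * r ≤ n := by exact_mod_cast this
    omega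
  obtain ⟨f, hf, hq⟩ := ri_maxdet W hW (3 * L ^ 2) (by
      intro v
      rw [hWZ]
      have := hZL v
      have := ri_dot_nonneg v
      nlinarith) (by
      rw [hWdef, trace_add, trace_smul, trace_one, smul_eq_mul, Fintype.card_fin]
      linarith) r (by linarith) hrn
  obtain ⟨τ, h1, h2⟩ := ri_flat (W.submatrix f f) (hW.posSemidef.submatrix f) hq
  refine ⟨τ.image f, ?_, ?_⟩
  · rw [Finset.card_image_of_injective _ hf, div_le_iff₀ hL0]
    rw [Fintype.card_fin] at h1
    have : ((r : ℝ) + 1) ≤ 64 * τ.card := by exact_mod_cast h1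
    nlinarith
  · intro x hx
    have hsum : ∀ g : Fin n → ℝ, (∀ i ∉ τ.image f, g i = 0) → ∑ i, g i = ∑ l, g (f l) := by
      intro g hg
      rw [← Finset.sum_subset (Finset.subset_univ (Finset.univ.image f)),
        Finset.sum_image (fun a _ b _ h => hf h)]
      intro i _ hi
      apply hg
      intro h
      exact hi (Finset.image_subset_image (Finset.subset_univ _) h)
    have h3 := h2 (fun l => x (f l)) (by
      intro l hl
      apply hx
      rw [Finset.mem_image]
      rintro ⟨a, ha, hab⟩
      exact hl (hf hab ▸ ha))
    have e1 : (fun l => x (f l)) ⬝ᵥ (fun l => x (f l)) = x ⬝ᵥ x := by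
      simp only [dotProduct]
      exact (hsum (fun i => x i * x i) fun i hi => by simp [hx i hi]).symm
    have e2 : (fun l => x (f l)) ⬝ᵥ (W.submatrix f f) *ᵥ (fun l => x (f l)) = x ⬝ᵥ W *ᵥ x := by
      simp only [dotProduct, mulVec, submatrix_apply]
      rw [hsum (fun i => x i * ∑ k, W i k * x k) fun i hi => by simp [hx i hi]]
      refine Finset.sum_congr rfl fun l _ => ?_
      rw [hsum (fun k => W (f l) k * x k) fun i hi => by simp [hx i hi]]
    rw [e1, e2, hWZ] at h3
    linarith

noncomputable def riP {n : ℕ} (φ : (Fin n → ℝ) → ℝ) (S : Matrix (Fin n) (Fin n) ℝ) : ℝ :=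
  sInf {a | ∃ l : List (Fin n → ℝ),
    (∀ v : Fin n → ℝ, v ⬝ᵥ S *ᵥ v ≤ (l.map fun x => (x ⬝ᵥ v) ^ 2).sum) ∧ a = (l.map φ).sum}

lemma riP_nonempty {n : ℕ} (φ : (Fin n → ℝ) → ℝ) (S : Matrix (Fin n) (Fin n) ℝ) :
    {a | ∃ l : List (Fin n → ℝ),
    (∀ v : Fin n → ℝ, v ⬝ᵥ S *ᵥ v ≤ (l.map fun x => (x ⬝ᵥ v) ^ 2).sum) ∧
      a = (l.map φ).sum}.Nonempty := by
  set C : ℝ := ∑ i, ∑ j, |S i j| with hC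
  have hC0 : 0 ≤ C := Finset.sum_nonneg fun i _ => Finset.sum_nonneg fun j _ => abs_nonneg _
  refine ⟨_, (List.finRange n).map (fun i => √C • Pi.single i (1 : ℝ)), ?_, rfl⟩
  intro v
  rw [List.map_map]
  have h1 : (List.map ((fun x : Fin n → ℝ => (x ⬝ᵥ v) ^ 2) ∘ fun i => √C • Pi.single i (1 : ℝ))
      (List.finRange n)).sum = C * (v ⬝ᵥ v) := by
    have e : ((fun x : Fin n → ℝ => (x ⬝ᵥ v) ^ 2) ∘ fun i => √C • Pi.single i (1 : ℝ)) =
        fun i => C * (v i * v i) := by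
      ext i
      simp only [Function.comp, smul_dotProduct, smul_eq_mul, single_dotProduct, one_mul, mul_pow,
        Real.sq_sqrt hC0]
      ring
    rw [e, ← List.ofFn_eq_map, List.sum_ofFn]; simp [dotProduct, Finset.mul_sum]
  rw [h1, hC, Finset.sum_mul]
  rw [dotProduct]
  refine Finset.sum_le_sum fun i _ => ?_
  rw [mulVec, dotProduct, Finset.mul_sum, Finset.sum_mul]
  refine Finset.sum_le_sum fun j _ => ?_
  have hi : v i ^ 2 ≤ v ⬝ᵥ v := by
    rw [dotProduct]; simp only [← sq]
    exact Finset.single_le_sum (f := fun i => v i ^ 2) (fun i _ => sq_nonneg _) (Finset.mem_univ i)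
  have hj : v j ^ 2 ≤ v ⬝ᵥ v := by
    rw [dotProduct]; simp only [← sq]
    exact Finset.single_le_sum (f := fun i => v i ^ 2) (fun i _ => sq_nonneg _) (Finset.mem_univ j)
  have h2 : |v i * v j| ≤ v ⬝ᵥ v := by
    rw [abs_le]; constructor <;> nlinarith [sq_nonneg (v i - v j), sq_nonneg (v i + v j)]
  calc v i * (S i j * v j) ≤ |S i j * (v i * v j)| := by
        refine le_trans (le_of_eq ?_) (le_abs_self _); ring
    _ = |S i j| * |v i * v j| := abs_mul _ _
    _ ≤ |S i j| * (v ⬝ᵥ v) := by gcongr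

lemma riP_bdd {n : ℕ} (φ : (Fin n → ℝ) → ℝ) (hφ : ∀ x, 0 ≤ φ x) (S : Matrix (Fin n) (Fin n) ℝ) :
    BddBelow {a | ∃ l : List (Fin n → ℝ),
    (∀ v : Fin n → ℝ, v ⬝ᵥ S *ᵥ v ≤ (l.map fun x => (x ⬝ᵥ v) ^ 2).sum) ∧ a = (l.map φ).sum} := by
  refine ⟨0, ?_⟩
  rintro a ⟨l, -, rfl⟩
  apply List.sum_nonneg
  intro a ha
  obtain ⟨x, -, rfl⟩ := List.mem_map.1 ha
  exact hφ x

lemma riP_le {n : ℕ} (φ : (Fin n → ℝ) → ℝ) (hφ : ∀ x, 0 ≤ φ x) (S : Matrix (Fin n) (Fin n) ℝ)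
    (l : List (Fin n → ℝ)) (hl : ∀ v : Fin n → ℝ, v ⬝ᵥ S *ᵥ v ≤ (l.map fun x => (x ⬝ᵥ v) ^ 2).sum) :
    riP φ S ≤ (l.map φ).sum :=
  csInf_le (riP_bdd φ hφ S) ⟨l, hl, rfl⟩

lemma le_riP {n : ℕ} (φ : (Fin n → ℝ) → ℝ) (S : Matrix (Fin n) (Fin n) ℝ) (a : ℝ)
    (h : ∀ l : List (Fin n → ℝ), (∀ v : Fin n → ℝ,
      v ⬝ᵥ S *ᵥ v ≤ (l.map fun x => (x ⬝ᵥ v) ^ 2).sum) → a ≤ (l.map φ).sum) : a ≤ riP φ S := by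
  refine le_csInf (riP_nonempty φ S) ?_
  rintro b ⟨l, hl, rfl⟩
  exact h l hl

lemma ri_dual {n : ℕ} (hn : 0 < n) (φ : (Fin n → ℝ) → ℝ) (hφ : ∀ x, 0 ≤ φ x)
    (hφh : ∀ (c : ℝ) x, φ (c • x) = c ^ 2 * φ x)
    (hkey : ∀ l : List (Fin n → ℝ), (∀ v : Fin n → ℝ, v ⬝ᵥ v ≤ (l.map fun x => (x ⬝ᵥ v) ^ 2).sum) →
      (n : ℝ) ≤ (l.map φ).sum) :
    ∃ Z : Matrix (Fin n) (Fin n) ℝ, Z.PosSemidef ∧ (n : ℝ) ≤ Z.trace ∧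
      ∀ x : Fin n → ℝ, x ⬝ᵥ Z *ᵥ x ≤ φ x := by
  have hp0 : ∀ S, 0 ≤ riP φ S := fun S => le_riP φ S 0 fun l _ => by
    apply List.sum_nonneg
    intro a ha
    obtain ⟨x, -, rfl⟩ := List.mem_map.1 ha
    exact hφ x
  have hhom1 : ∀ c : ℝ, 0 < c → ∀ S, riP φ (c • S) ≤ c * riP φ S := by
    intro c hc S
    rw [← div_le_iff₀' hc]
    refine le_riP φ S _ fun l hl => ?_
    rw [div_le_iff₀' hc]
    refine (riP_le φ hφ (c • S) (l.map fun x => √c • x) ?_).trans (le_of_eq ?_)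
    · intro v
      have e : (fun x : Fin n → ℝ => (x ⬝ᵥ v) ^ 2) ∘ (fun x => √c • x) =
          fun x => c * (x ⬝ᵥ v) ^ 2 := by
        ext x
        simp only [Function.comp, smul_dotProduct, smul_eq_mul, mul_pow, Real.sq_sqrt hc.le]
      rw [List.map_map, e, List.sum_map_mul_left, smul_mulVec, dotProduct_smul, smul_eq_mul]
      exact mul_le_mul_of_nonneg_left (hl v) hc.le
    · have e : φ ∘ (fun x => √c • x) = fun x => c * φ x := by
        ext x
        simp only [Function.comp, hφh, Real.sq_sqrt hc.le]
      rw [List.map_map, e, List.sum_map_mul_left]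
  have hhom : ∀ c : ℝ, 0 < c → ∀ S, riP φ (c • S) = c * riP φ S := by
    intro c hc S
    refine le_antisymm (hhom1 c hc S) ?_
    have := hhom1 c⁻¹ (by positivity) (c • S)
    rw [smul_smul, inv_mul_cancel₀ hc.ne', one_smul] at this
    rwa [le_inv_mul_iff₀ hc] at this
  have hadd : ∀ S S', riP φ (S + S') ≤ riP φ S + riP φ S' := by
    intro S S'
    rw [← sub_le_iff_le_add]
    refine le_riP φ S _ fun l hl => ?_
    rw [sub_le_iff_le_add, ← sub_le_iff_le_add']
    refine le_riP φ S' _ fun l' hl' => ?_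
    rw [sub_le_iff_le_add', ← List.sum_append, ← List.map_append]
    refine riP_le φ hφ _ _ fun v => ?_
    rw [add_mulVec, dotProduct_add, List.map_append, List.sum_append]
    exact add_le_add (hl v) (hl' v)
  have hne : (1 : Matrix (Fin n) (Fin n) ℝ) ≠ 0 := by
    intro h
    have := congrFun (congrFun h ⟨0, hn⟩) ⟨0, hn⟩
    simp at this
  obtain ⟨g, hg1, hg2⟩ := exists_extension_of_le_sublinear
    (LinearPMap.mkSpanSingleton (σ := RingHom.id ℝ) (1 : Matrix (Fin n) (Fin n) ℝ) (riP φ 1) hne) (riP φ) hhom hadd (by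
      rintro ⟨x, hx⟩
      obtain ⟨c, rfl⟩ := Submodule.mem_span_singleton.1 hx
      refine (le_of_eq (LinearPMap.mkSpanSingleton'_apply (σ := RingHom.id ℝ) (1 : Matrix (Fin n) (Fin n) ℝ) (riP φ 1)
        _ c hx)).trans ?_
      simp only [smul_eq_mul]
      rcases lt_or_ge 0 c with hc | hc
      · exact (hhom c hc _).ge
      · exact (mul_nonpos_of_nonpos_of_nonneg hc (hp0 _)).trans (hp0 _))
  have hgone : g 1 = riP φ 1 := by
    have h1 : (1 : Matrix (Fin n) (Fin n) ℝ) ∈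
        (LinearPMap.mkSpanSingleton (σ := RingHom.id ℝ) (1 : Matrix (Fin n) (Fin n) ℝ) (riP φ 1) hne).domain :=
      Submodule.mem_span_singleton_self (R := ℝ) _
    have := hg1 ⟨_, h1⟩
    rw [LinearPMap.mkSpanSingleton_apply] at this
    simpa using this
  have hgn : (n : ℝ) ≤ g 1 := by
    rw [hgone]
    refine le_riP φ 1 _ fun l hl => hkey l fun v => ?_
    simpa using hl v
  set Z : Matrix (Fin n) (Fin n) ℝ := Matrix.of fun i j => g (Matrix.single i j 1) with hZ
  have hquad : ∀ x : Fin n → ℝ, x ⬝ᵥ Z *ᵥ x = g (vecMulVec x x) := by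
    intro x
    rw [Matrix.matrix_eq_sum_single (vecMulVec x x), map_sum]
    rw [dotProduct]
    refine Finset.sum_congr rfl fun i _ => ?_
    rw [map_sum, mulVec, dotProduct, Finset.mul_sum]
    refine Finset.sum_congr rfl fun j _ => ?_
    have : Matrix.single i j (vecMulVec x x i j) = (x i * x j) • Matrix.single i j (1 : ℝ) := by
      rw [Matrix.smul_single, vecMulVec_apply]; simp
    rw [this, map_smul, hZ]
    simp only [of_apply, smul_eq_mul]
    ring
  have hvv : ∀ x v : Fin n → ℝ, v ⬝ᵥ vecMulVec x x *ᵥ v = (x ⬝ᵥ v) ^ 2 := by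
    intro x v
    rw [vecMulVec_mulVec]
    simp [dotProduct_comm v, sq]
  refine ⟨Z, ?_, ?_, ?_⟩
  · refine Matrix.PosSemidef.of_dotProduct_mulVec_nonneg ?_ ?_
    · have key : ∀ i j, g (Matrix.single i j 1) ≤ g (Matrix.single j i 1) := by
        intro i j
        rw [← sub_nonpos, ← map_sub]
        refine (hg2 _).trans ((riP_le φ hφ _ [] ?_).trans (by simp))
        intro v
        rw [sub_mulVec, dotProduct_sub]
        simp [Matrix.single_mulVec, dotProduct, Function.update_apply, mul_comm]
      ext i j
      simp only [conjTranspose_apply, star_trivial, hZ, of_apply]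
      exact le_antisymm (key _ _) (key _ _)
    · intro x
      rw [star_trivial, hquad, ← neg_nonpos, ← map_neg]
      refine (hg2 _).trans ((riP_le φ hφ _ [] ?_).trans (by simp))
      intro v
      rw [neg_mulVec, dotProduct_neg, hvv]
      simp
      positivity
  · have : Z.trace = g 1 := by
      rw [← Matrix.diagonal_one, ← Matrix.sum_single_eq_diagonal, map_sum]
      rfl
    rw [this]; exact hgn
  · intro x
    rw [hquad]
    refine (hg2 _).trans ((riP_le φ hφ _ [x] ?_).trans (by simp))
    intro v
    rw [hvv]
    simp
end

section
open ProbabilityTheory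

lemma ri_memLp {E X : Type*} [NormedAddCommGroup E] [InnerProductSpace ℝ E] [FiniteDimensional ℝ E]
    [MeasurableSpace E] [BorelSpace E] [NormedAddCommGroup X] [NormedSpace ℝ X]
    (A : E →L[ℝ] X) (z : X) : MemLp (fun g => ‖A g + z‖) 2 (stdGaussian E) := by
  have h : MemLp (fun g : E => ‖A‖ * ‖g‖ + ‖z‖) 2 (stdGaussian E) :=
    ((IsGaussian.memLp_two_id (μ := stdGaussian E)).norm.const_mul _).add (memLp_const _)
  refine h.mono (by fun_prop) (Filter.Eventually.of_forall fun g => ?_)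
  rw [norm_norm, Real.norm_of_nonneg (by positivity)]
  exact (norm_add_le _ _).trans (add_le_add_left (A.le_opNorm g) _)

lemma ri_memLp' {E X : Type*} [NormedAddCommGroup E] [InnerProductSpace ℝ E] [FiniteDimensional ℝ E]
    [MeasurableSpace E] [BorelSpace E] [NormedAddCommGroup X] [NormedSpace ℝ X]
    (A : E →L[ℝ] X) : MemLp (fun g => ‖A g‖) 2 (stdGaussian E) := by
  simpa using ri_memLp A 0

/-- second moment versus first moment -/
lemma ri_moment {E X : Type*} [NormedAddCommGroup E] [InnerProductSpace ℝ E] [FiniteDimensional ℝ E]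
    [MeasurableSpace E] [BorelSpace E] [NormedAddCommGroup X] [NormedSpace ℝ X]
    (A : E →L[ℝ] X) : ∫ g, ‖A g‖ ^ 2 ∂(stdGaussian E) ≤ 2 * (∫ g, ‖A g‖ ∂(stdGaussian E)) ^ 2 := by
  set μ := stdGaussian E with hμ
  have hf := ri_memLp' A
  rw [← hμ] at hf
  have hf1 : Integrable (fun g => ‖A g‖) μ := hf.integrable (by norm_num)
  have hf2 : Integrable (fun g => ‖A g‖ ^ 2) μ := hf.integrable_sq
  have hrot : (μ.prod μ).map (ContinuousLinearMap.rotation (Real.pi / 4)) = μ.prod μ :=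
    IsGaussian.map_rotation_eq_self (by simp [hμ]) _
  have hprod : Integrable (fun p : E × E => ‖A p.1‖ * ‖A p.2‖) (μ.prod μ) := hf1.mul_prod hf1
  have hI : ∫ p : E × E, ‖A p.1‖ * ‖A p.2‖ ∂(μ.prod μ) = (∫ g, ‖A g‖ ∂μ) ^ 2 := by
    rw [integral_prod_mul (fun g => ‖A g‖) (fun g => ‖A g‖), sq]
  have hprod' : Integrable ((fun p : E × E => ‖A p.1‖ * ‖A p.2‖) ∘
      (ContinuousLinearMap.rotation (Real.pi / 4))) (μ.prod μ) := by
    rw [← integrable_map_measure (by fun_prop) (by fun_prop), hrot]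
    exact hprod
  have hI' : ∫ p : E × E, ((fun p : E × E => ‖A p.1‖ * ‖A p.2‖) ∘
      (ContinuousLinearMap.rotation (Real.pi / 4))) p ∂(μ.prod μ) = (∫ g, ‖A g‖ ∂μ) ^ 2 := by
    rw [← hI]
    conv_rhs => rw [← hrot]
    rw [integral_map (by fun_prop) (by fun_prop)]
    rfl
  have hs1 : Integrable (fun p : E × E => ‖A p.1‖ ^ 2) (μ.prod μ) := hf2.comp_fst μ
  have hs2 : Integrable (fun p : E × E => ‖A p.2‖ ^ 2) (μ.prod μ) := hf2.comp_snd μ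
  have hpt : ∀ p : E × E, ‖A p.1‖ ^ 2 + ‖A p.2‖ ^ 2 - 2 * (‖A p.1‖ * ‖A p.2‖) ≤
      2 * ((fun p : E × E => ‖A p.1‖ * ‖A p.2‖) ∘
      (ContinuousLinearMap.rotation (Real.pi / 4))) p := by
    rintro ⟨x, y⟩
    simp only [Function.comp, ContinuousLinearMap.rotation_apply, Real.cos_pi_div_four,
      Real.sin_pi_div_four]
    have e1 : A ((√2 / 2) • x + (√2 / 2) • y) = (√2 / 2) • (A x + A y) := by
      simp [smul_add]
    have e2 : A (-(√2 / 2) • x + (√2 / 2) • y) = (√2 / 2) • (A y - A x) := by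
      simp only [map_add, map_smul, map_neg, smul_sub, neg_smul]; abel
    rw [e1, e2, norm_smul, norm_smul, Real.norm_of_nonneg (by positivity)]
    have hsq : √2 * √2 = 2 := Real.mul_self_sqrt (by norm_num)
    have h1 : |‖A x‖ - ‖A y‖| ≤ ‖A y - A x‖ := by
      rw [norm_sub_rev]; exact abs_norm_sub_norm_le _ _
    have h2 : |‖A x‖ - ‖A y‖| ≤ ‖A x + A y‖ := by
      have := abs_norm_sub_norm_le (A x) (-A y)
      simpa using this
    have h3 := mul_le_mul h1 h2 (abs_nonneg _) (norm_nonneg _)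
    rw [abs_mul_abs_self] at h3
    have h4 : 2 * (√2 / 2 * ‖A x + A y‖ * (√2 / 2 * ‖A y - A x‖)) =
      (√2 * √2) / 2 * (‖A y - A x‖ * ‖A x + A y‖) := by ring
    rw [h4, hsq]
    nlinarith
  have hm := integral_mono (((hs1.add hs2).sub (hprod.const_mul 2))) (hprod'.const_mul 2) hpt
  rw [integral_const_mul, hI'] at hm
  have e : ∫ p : E × E, (‖A p.1‖ ^ 2 + ‖A p.2‖ ^ 2 - 2 * (‖A p.1‖ * ‖A p.2‖)) ∂(μ.prod μ) =
      2 * ∫ g, ‖A g‖ ^ 2 ∂μ - 2 * (∫ g, ‖A g‖ ∂μ) ^ 2 := by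
    have hs : Integrable (fun p : E × E => ‖A p.1‖ ^ 2 + ‖A p.2‖ ^ 2) (μ.prod μ) := hs1.add hs2
    rw [integral_sub hs (hprod.const_mul 2), integral_add hs1 hs2, integral_const_mul,
      hI, integral_fun_fst (fun g => ‖A g‖ ^ 2), integral_fun_snd (fun g => ‖A g‖ ^ 2)]
    simp; ring
  have hm' : ∫ p : E × E, (‖A p.1‖ ^ 2 + ‖A p.2‖ ^ 2 - 2 * (‖A p.1‖ * ‖A p.2‖)) ∂(μ.prod μ) ≤
    2 * (∫ g, ‖A g‖ ∂μ) ^ 2 := hm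
  rw [e] at hm'
  linarith

lemma ri_var {E : Type*} [NormedAddCommGroup E] [InnerProductSpace ℝ E] [FiniteDimensional ℝ E]
    [MeasurableSpace E] [BorelSpace E] (L : StrongDual ℝ E) :
    ∫ g, (L g) ^ 2 ∂(stdGaussian E) = ‖L‖ ^ 2 := by
  rw [← variance_dual_stdGaussian, variance_of_integral_eq_zero (by fun_prop)
    (integral_strongDual_stdGaussian L)]

/-- domination -/
lemma ri_domin {E F X : Type*} [NormedAddCommGroup E] [InnerProductSpace ℝ E]
    [FiniteDimensional ℝ E] [MeasurableSpace E] [BorelSpace E] 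
    [NormedAddCommGroup F] [InnerProductSpace ℝ F]
    [FiniteDimensional ℝ F] [MeasurableSpace F] [BorelSpace F] [NormedAddCommGroup X]
    [NormedSpace ℝ X] (S : E →L[ℝ] F) (W : F →L[ℝ] F) (T : F →L[ℝ] X)
    (h : ∀ L : StrongDual ℝ F, ‖L.comp S‖ ^ 2 = ‖L‖ ^ 2 + ‖L.comp W‖ ^ 2) :
    ∫ y, ‖T y‖ ^ 2 ∂(stdGaussian F) ≤ ∫ g, ‖T (S g)‖ ^ 2 ∂(stdGaussian E) := by
  set γ := stdGaussian F with hγ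
  set ν := γ.map W with hν
  have : IsProbabilityMeasure ν := Measure.isProbabilityMeasure_map (by fun_prop)
  have hlaw : (stdGaussian E).map S = (γ.prod ν).map (fun p => p.1 + p.2) := by
    have : IsProbabilityMeasure ((stdGaussian E).map S) :=
      Measure.isProbabilityMeasure_map (by fun_prop)
    refine Measure.ext_of_charFunDual ?_
    ext L
    rw [charFunDual_map_add_prod_eq_mul, Pi.mul_apply, hν, charFunDual_map, charFunDual_map,
      hγ, charFunDual_stdGaussian, charFunDual_stdGaussian, charFunDual_stdGaussian,
      ← Complex.exp_add]
    congr 1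
    have := h L
    norm_cast
    rw [this]
    ring
  have hsymm : γ.map (LinearIsometryEquiv.neg ℝ) = γ := stdGaussian_map _
  have h1 : ∫ g, ‖T (S g)‖ ^ 2 ∂(stdGaussian E) = ∫ p : F × F, ‖T (p.1 + p.2)‖ ^ 2 ∂(γ.prod ν) := by
    have a1 : ∫ y, ‖T y‖ ^ 2 ∂((stdGaussian E).map S) = ∫ g, ‖T (S g)‖ ^ 2 ∂(stdGaussian E) :=
      integral_map (by fun_prop) (by fun_prop)
    rw [← a1, hlaw, integral_map (by fun_prop) (by fun_prop)]
  have hint : Integrable (fun p : F × F => ‖T (p.1 + p.2)‖ ^ 2) (γ.prod ν) := by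
    have a1 : Integrable (fun y => ‖T y‖ ^ 2) ((stdGaussian E).map S) := by
      rw [integrable_map_measure (by fun_prop) (by fun_prop)]
      exact (ri_memLp' (T.comp S)).integrable_sq
    rw [hlaw, integrable_map_measure (by fun_prop) (by fun_prop)] at a1
    exact a1
  rw [h1, integral_prod_symm _ hint]
  have h2 : ∀ z, ∫ y, ‖T y‖ ^ 2 ∂γ ≤ ∫ y, ‖T (y + z)‖ ^ 2 ∂γ := by
    intro z
    have i0 : Integrable (fun y => ‖T y‖ ^ 2) γ := (ri_memLp' T).integrable_sq
    have i1 : Integrable (fun y => ‖T (y + z)‖ ^ 2) γ := by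
      simpa using (ri_memLp T (T z)).integrable_sq
    have i2 : Integrable (fun y => ‖T (y - z)‖ ^ 2) γ := by
      simpa [sub_eq_add_neg] using (ri_memLp T (-T z)).integrable_sq
    have e : ∫ y, ‖T (y - z)‖ ^ 2 ∂γ = ∫ y, ‖T (y + z)‖ ^ 2 ∂γ := by
      conv_lhs => rw [← hsymm]
      rw [integral_map (by fun_prop) (by fun_prop)]
      refine integral_congr_ae (Filter.Eventually.of_forall fun y => ?_)
      have : T (LinearIsometryEquiv.neg ℝ y - z) = - T (y + z) := by
        simp; abel
      simp only [this, norm_neg]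
    have hm : ∫ y, 2 * ‖T y‖ ^ 2 ∂γ ≤ ∫ y, (‖T (y + z)‖ ^ 2 + ‖T (y - z)‖ ^ 2) ∂γ := by
      refine integral_mono (i0.const_mul 2) (i1.add i2) fun y => ?_
      have a : T y = (2 : ℝ)⁻¹ • (T (y + z) + T (y - z)) := by
        rw [← map_add, ← map_smul]; congr 1
        rw [add_add_sub_cancel, ← two_smul ℝ y, smul_smul]; norm_num
      have b : ‖T y‖ ≤ 2⁻¹ * (‖T (y + z)‖ + ‖T (y - z)‖) := by
        calc ‖T y‖ = 2⁻¹ * ‖T (y + z) + T (y - z)‖ := by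
              conv_lhs => rw [a, norm_smul]
              norm_num
          _ ≤ _ := by gcongr; exact norm_add_le _ _
      have c := norm_nonneg (T y)
      simp only
      nlinarith [sq_nonneg (‖T (y + z)‖ - ‖T (y - z)‖)]
    rw [integral_const_mul, integral_add i1 i2, e] at hm
    linarith
  have h3 : ∫ y, ‖T y‖ ^ 2 ∂γ = ∫ z, (∫ y, ‖T y‖ ^ 2 ∂γ) ∂ν := by simp
  rw [h3]
  exact integral_mono (integrable_const _) hint.integral_prod_right h2
end

section
open ProbabilityTheory

noncomputable def riA {X : Type*} [NormedAddCommGroup X] [NormedSpace ℝ X] {m : ℕ} (x : Fin m → X) :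
    EuclideanSpace ℝ (Fin m) →L[ℝ] X :=
  ∑ j, (EuclideanSpace.proj j : EuclideanSpace ℝ (Fin m) →L[ℝ] ℝ).smulRight (x j)

lemma riA_apply {X : Type*} [NormedAddCommGroup X] [NormedSpace ℝ X] {m : ℕ} (x : Fin m → X)
    (g : EuclideanSpace ℝ (Fin m)) : riA x g = ∑ j, g j • x j := by
  simp [riA]

lemma ri_inner_sq {m : ℕ} (a : EuclideanSpace ℝ (Fin m)) :
    ∫ g, (∑ j, g j * a j) ^ 2 ∂(stdGaussian (EuclideanSpace ℝ (Fin m))) = ∑ j, a j ^ 2 := by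
  have := ri_var (innerSL ℝ a)
  rw [innerSL_apply_norm, EuclideanSpace.real_norm_sq_eq] at this
  rw [← this]
  refine integral_congr_ae (Filter.Eventually.of_forall fun g => ?_)
  simp [PiLp.inner_apply]

lemma ri_coord {m : ℕ} (i : Fin m) :
    ∫ g, (g i) ^ 2 ∂(stdGaussian (EuclideanSpace ℝ (Fin m))) = 1 := by
  have := ri_inner_sq (EuclideanSpace.single i (1 : ℝ))
  simpa [Pi.single_apply] using this

lemma ri_coord_int {m : ℕ} (i : Fin m) :
    Integrable (fun g : EuclideanSpace ℝ (Fin m) => (g i) ^ 2)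
      (stdGaussian (EuclideanSpace ℝ (Fin m))) := by
  have := (ri_memLp' (EuclideanSpace.proj i : EuclideanSpace ℝ (Fin m) →L[ℝ] ℝ)).integrable_sq
  simpa using this

lemma ri_type2 {X : Type*} [NormedAddCommGroup X] [NormedSpace ℝ X] {m : ℕ} (x : Fin m → X)
    (M : ℝ) (hM0 : 0 ≤ M) (hM : IsType2With X M) :
    ∫ g, ‖riA x g‖ ^ 2 ∂(stdGaussian (EuclideanSpace ℝ (Fin m))) ≤ 2 * M ^ 2 * ∑ j, ‖x j‖ ^ 2 := by
  set γ := stdGaussian (EuclideanSpace ℝ (Fin m)) with hγ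
  have hflip : ∀ ε : Fin m → Bool, ∫ g, ‖riA x g‖ ∂γ =
      ∫ g, ‖∑ i, (if ε i then g i • x i else -(g i • x i))‖ ∂γ := by
    intro ε
    set f : EuclideanSpace ℝ (Fin m) ≃ₗᵢ[ℝ] EuclideanSpace ℝ (Fin m) :=
      LinearIsometryEquiv.piLpCongrRight 2
        (fun i => if ε i then LinearIsometryEquiv.refl ℝ ℝ else LinearIsometryEquiv.neg ℝ) with hf
    have hmap : γ.map f = γ := stdGaussian_map f
    conv_lhs => rw [← hmap]
    rw [integral_map (by fun_prop) (by fun_prop)]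
    refine integral_congr_ae (Filter.Eventually.of_forall fun g => ?_)
    simp only [riA_apply]
    congr 1
    refine Finset.sum_congr rfl fun i _ => ?_
    have : f g i = if ε i then g i else - g i := by
      rw [hf, LinearIsometryEquiv.piLpCongrRight_apply]
      simp only
      split_ifs <;> simp
    rw [this]
    split_ifs <;> simp
  have hi : ∀ ε : Fin m → Bool,
      Integrable (fun g : EuclideanSpace ℝ (Fin m) =>
        ‖∑ i, (if ε i then g i • x i else -(g i • x i))‖) γ := by
    intro ε
    have := (ri_memLp' (riA fun i => if ε i then x i else - x i)).integrable (by norm_num)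
    refine this.congr (Filter.Eventually.of_forall fun g => ?_)
    simp only [riA_apply]
    congr 1
    refine Finset.sum_congr rfl fun i _ => ?_
    split_ifs <;> simp
  set q : EuclideanSpace ℝ (Fin m) → ℝ := fun g => ∑ i, ‖g i • x i‖ ^ 2 with hq
  have hq0 : ∀ g, 0 ≤ q g := fun g => Finset.sum_nonneg fun i _ => sq_nonneg _
  have hqe : ∀ g, q g = ∑ i, (g i) ^ 2 * ‖x i‖ ^ 2 := by
    intro g
    refine Finset.sum_congr rfl fun i _ => ?_
    rw [norm_smul, mul_pow, Real.norm_eq_abs, sq_abs]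
  have hqc : Continuous q := by rw [hq]; fun_prop
  have hqi : Integrable q γ := by
    have : q = fun g => ∑ i, (g i) ^ 2 * ‖x i‖ ^ 2 := funext hqe
    rw [this]
    exact integrable_finsetSum _ fun i _ => (ri_coord_int i).mul_const _
  have hqI : ∫ g, q g ∂γ = ∑ i, ‖x i‖ ^ 2 := by
    simp only [hqe]
    rw [integral_finsetSum _ fun i _ => (ri_coord_int i).mul_const _]
    refine Finset.sum_congr rfl fun i _ => ?_
    rw [integral_mul_const, ri_coord, one_mul]
  have hL2 : MemLp (fun g => √(q g)) 2 γ := by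
    rw [memLp_two_iff_integrable_sq (hqc.sqrt).aestronglyMeasurable]
    refine hqi.congr (Filter.Eventually.of_forall fun g => ?_)
    simp only [Real.sq_sqrt (hq0 g)]
  have hsq : (∫ g, √(q g) ∂γ) ^ 2 ≤ ∑ i, ‖x i‖ ^ 2 := by
    have hv := variance_nonneg (fun g => √(q g)) γ
    rw [variance_eq_sub hL2] at hv
    have e : ∫ g, ((fun g => √(q g)) ^ 2) g ∂γ = ∑ i, ‖x i‖ ^ 2 := by
      rw [← hqI]
      refine integral_congr_ae (Filter.Eventually.of_forall fun g => ?_)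
      simp [Real.sq_sqrt (hq0 g)]
    rw [e] at hv
    linarith
  have hsI : Integrable (fun g => √(q g)) γ := hL2.integrable (by norm_num)
  have h1 : ∫ g, ‖riA x g‖ ∂γ ≤ M * ∫ g, √(q g) ∂γ := by
    have e : ∫ g, ‖riA x g‖ ∂γ = ∫ g : EuclideanSpace ℝ (Fin m), (∑ ε : Fin m → Bool,
        ‖∑ i, (if ε i then g i • x i else -(g i • x i))‖) / 2 ^ m ∂γ := by
      rw [integral_div, integral_finsetSum _ fun ε _ => hi ε]
      rw [← Finset.sum_congr rfl fun ε _ => hflip ε]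
      simp
    rw [e, ← integral_const_mul]
    refine integral_mono ((integrable_finsetSum _ fun ε _ => hi ε).div_const _) (hsI.const_mul _) ?_
    intro g
    exact hM m fun i => g i • x i
  have h0 : 0 ≤ ∫ g, ‖riA x g‖ ∂γ := integral_nonneg fun _ => norm_nonneg _
  calc ∫ g, ‖riA x g‖ ^ 2 ∂γ ≤ 2 * (∫ g, ‖riA x g‖ ∂γ) ^ 2 := ri_moment _
    _ ≤ 2 * (M * ∫ g, √(q g) ∂γ) ^ 2 := by gcongr
    _ = 2 * M ^ 2 * (∫ g, √(q g) ∂γ) ^ 2 := by ring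
    _ ≤ _ := by gcongr

lemma ri_hilb {n m : ℕ} (y : Fin m → EuclideanSpace ℝ (Fin n)) :
    ∫ g, ‖riA y g‖ ^ 2 ∂(stdGaussian (EuclideanSpace ℝ (Fin m))) = ∑ j, ‖y j‖ ^ 2 := by
  have e : ∀ g, ‖riA y g‖ ^ 2 = ∑ i, (∑ j, g j * (WithLp.toLp 2 (fun j => y j i) :
      EuclideanSpace ℝ (Fin m)) j) ^ 2 := by
    intro g
    rw [EuclideanSpace.real_norm_sq_eq]
    simp [riA_apply]
  simp only [e]
  rw [integral_finsetSum]
  · rw [Finset.sum_congr rfl fun i _ => ri_inner_sq (WithLp.toLp 2 fun j => y j i)]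
    rw [Finset.sum_comm]
    simp [EuclideanSpace.real_norm_sq_eq]
  · intro i _
    have := (ri_memLp' (innerSL ℝ (WithLp.toLp 2 (fun j => y j i) :
      EuclideanSpace ℝ (Fin m)))).integrable_sq
    refine this.congr (Filter.Eventually.of_forall fun g => ?_)
    simp [PiLp.inner_apply]

lemma ri_split {X : Type*} [NormedAddCommGroup X] [NormedSpace ℝ X] {n m : ℕ}
    (T : EuclideanSpace ℝ (Fin n) →L[ℝ] X)
    (M : ℝ) (hM0 : 0 ≤ M) (hM : IsType2With X M) (ζ : Fin m → EuclideanSpace ℝ (Fin n)) :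
    ∫ g, ‖T (riA ζ g)‖ ^ 2 ∂(stdGaussian (EuclideanSpace ℝ (Fin m))) ≤
      ∑ j, min (4 * M ^ 2 * ‖T (ζ j)‖ ^ 2) (2 * ‖T‖ ^ 2 * ‖ζ j‖ ^ 2) := by
  classical
  set γ := stdGaussian (EuclideanSpace ℝ (Fin m)) with hγ
  set P : Fin m → Prop := fun j => 4 * M ^ 2 * ‖T (ζ j)‖ ^ 2 ≤ 2 * ‖T‖ ^ 2 * ‖ζ j‖ ^ 2 with hP
  set x : Fin m → X := fun j => if P j then T (ζ j) else 0 with hx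
  set y : Fin m → EuclideanSpace ℝ (Fin n) := fun j => if P j then 0 else ζ j with hy
  have hdec : ∀ g, T (riA ζ g) = riA x g + T (riA y g) := by
    intro g
    simp only [riA_apply, map_sum, map_smul, ← Finset.sum_add_distrib]
    refine Finset.sum_congr rfl fun j _ => ?_
    by_cases h : P j <;> simp [hx, hy, h]
  have i1 : Integrable (fun g => ‖riA x g‖ ^ 2) γ := (ri_memLp' _).integrable_sq
  have i2 : Integrable (fun g => ‖riA y g‖ ^ 2) γ := (ri_memLp' _).integrable_sq
  have i0 : Integrable (fun g => ‖T (riA ζ g)‖ ^ 2) γ := (ri_memLp' (T.comp (riA ζ))).integrable_sq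
  have hm : ∫ g, ‖T (riA ζ g)‖ ^ 2 ∂γ ≤ ∫ g, (2 * ‖riA x g‖ ^ 2 + 2 * ‖T‖ ^ 2 * ‖riA y g‖ ^ 2) ∂γ := by
    refine integral_mono i0 ((i1.const_mul _).add (i2.const_mul _)) fun g => ?_
    have a : ‖T (riA ζ g)‖ ≤ ‖riA x g‖ + ‖T‖ * ‖riA y g‖ := by
      rw [hdec]; exact (norm_add_le _ _).trans (add_le_add_right (T.le_opNorm _) _)
    have b := norm_nonneg (T (riA ζ g))
    simp only
    nlinarith [sq_nonneg (‖riA x g‖ - ‖T‖ * ‖riA y g‖)]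
  rw [integral_add (i1.const_mul _) (i2.const_mul _), integral_const_mul, integral_const_mul,
    ri_hilb] at hm
  have h2 := ri_type2 x M hM0 hM
  refine hm.trans ?_
  calc _ ≤ 2 * (2 * M ^ 2 * ∑ j, ‖x j‖ ^ 2) + 2 * ‖T‖ ^ 2 * ∑ j, ‖y j‖ ^ 2 := by gcongr
    _ = ∑ j, (4 * M ^ 2 * ‖x j‖ ^ 2 + 2 * ‖T‖ ^ 2 * ‖y j‖ ^ 2) := by
        rw [Finset.sum_add_distrib, ← Finset.mul_sum, ← Finset.mul_sum]; ring
    _ ≤ _ := by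
        refine Finset.sum_le_sum fun j _ => le_of_eq ?_
        by_cases h : P j
        · rw [min_eq_left h]; simp [hx, hy, h]
        · rw [min_eq_right (not_le.1 h).le]; simp [hx, hy, h]

lemma ri_ell {X : Type*} [NormedAddCommGroup X] [NormedSpace ℝ X] {n : ℕ}
    (T : EuclideanSpace ℝ (Fin n) →L[ℝ] X) :
    ellNormSq T = ∫ y, ‖T y‖ ^ 2 ∂(stdGaussian (EuclideanSpace ℝ (Fin n))) := by
  rw [← map_pi_eq_stdGaussian, integral_map (by fun_prop) (by fun_prop)]
  rfl

lemma ri_key {X : Type*} [NormedAddCommGroup X] [NormedSpace ℝ X] {n m : ℕ}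
    (T : EuclideanSpace ℝ (Fin n) →L[ℝ] X)
    (M : ℝ) (hM0 : 0 ≤ M) (hM : IsType2With X M) (ζ : Fin m → EuclideanSpace ℝ (Fin n))
    (hζ : ∀ v : EuclideanSpace ℝ (Fin n), ‖v‖ ^ 2 ≤ ∑ j, (inner ℝ (ζ j) v) ^ 2) :
    ellNormSq T ≤ ∑ j, min (4 * M ^ 2 * ‖T (ζ j)‖ ^ 2) (2 * ‖T‖ ^ 2 * ‖ζ j‖ ^ 2) := by
  refine le_trans ?_ (ri_split T M hM0 hM ζ)
  rw [ri_ell]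
  -- covariance defect
  set D : Matrix (Fin n) (Fin n) ℝ :=
    (∑ j, Matrix.vecMulVec (ζ j).ofLp (ζ j).ofLp) - 1 with hD
  have hq : ∀ v : EuclideanSpace ℝ (Fin n),
      dotProduct v.ofLp (D.mulVec v.ofLp) = (∑ j, (inner ℝ (ζ j) v) ^ 2) - ‖v‖ ^ 2 := by
    intro v
    rw [hD, Matrix.sub_mulVec, dotProduct_sub, Matrix.one_mulVec, Matrix.sum_mulVec, dotProduct_sum]
    congr 1
    · refine Finset.sum_congr rfl fun j _ => ?_
      rw [Matrix.vecMulVec_mulVec]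
      simp only [PiLp.inner_apply, dotProduct, sq, Finset.sum_mul]
      refine Finset.sum_congr rfl fun i _ => ?_
      simp [mul_comm]
      ring
    · rw [EuclideanSpace.real_norm_sq_eq]; simp [dotProduct, sq]
  have hps : D.PosSemidef := by
    refine Matrix.PosSemidef.of_dotProduct_mulVec_nonneg ?_ ?_
    · ext i j
      simp [hD, Matrix.sum_apply, Matrix.vecMulVec_apply, mul_comm, Matrix.one_apply, eq_comm]
    · intro v
      have := hq (WithLp.toLp 2 v)
      simp only at this
      rw [star_trivial, this, sub_nonneg]
      exact hζ _
  obtain ⟨C, hC⟩ : ∃ C : Matrix (Fin n) (Fin n) ℝ, D = star C * C := by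
    open scoped MatrixOrder in
    exact CStarAlgebra.nonneg_iff_eq_star_mul_self.1 hps.nonneg
  set V : EuclideanSpace ℝ (Fin n) →L[ℝ] EuclideanSpace ℝ (Fin n) :=
    Matrix.toEuclideanCLM (𝕜 := ℝ) C with hV
  refine ri_domin (riA ζ) (ContinuousLinearMap.adjoint V) T ?_
  intro L
  obtain ⟨v, rfl⟩ := (InnerProductSpace.toDual ℝ (EuclideanSpace ℝ (Fin n))).surjective L
  have e1 : ((InnerProductSpace.toDual ℝ (EuclideanSpace ℝ (Fin n)) v)).comp (riA ζ) =
      innerSL ℝ (WithLp.toLp 2 (fun j => inner ℝ (ζ j) v) : EuclideanSpace ℝ (Fin m)) := by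
    ext g
    simp [riA_apply, PiLp.inner_apply, mul_comm]
  have e2 : ((InnerProductSpace.toDual ℝ (EuclideanSpace ℝ (Fin n)) v)).comp
      (ContinuousLinearMap.adjoint V) = innerSL ℝ (V v) := by
    ext g
    simp [ContinuousLinearMap.adjoint_inner_right]
  rw [e1, e2, innerSL_apply_norm, innerSL_apply_norm, LinearIsometryEquiv.norm_map]
  have e3 : ‖V v‖ ^ 2 = dotProduct v.ofLp (D.mulVec v.ofLp) := by
    rw [hC, ← Matrix.mulVec_mulVec, Matrix.dotProduct_mulVec, EuclideanSpace.real_norm_sq_eq]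
    have : Matrix.vecMul v.ofLp (star C) = C.mulVec v.ofLp := by
      rw [Matrix.star_eq_conjTranspose, Matrix.conjTranspose_eq_transpose_of_trivial,
        Matrix.vecMul_transpose]
    rw [this, hV]
    simp [dotProduct, sq]
  rw [e3, hq, EuclideanSpace.real_norm_sq_eq]
  simp
end

open scoped Matrix

lemma ri_type2Const {X : Type*} [NormedAddCommGroup X] (h : ∃ M : ℝ, IsType2With X M) :
    0 ≤ type2Const X ∧ IsType2With X (type2Const X) := by
  obtain ⟨M, hM⟩ := h
  have hne : {M : ℝ | 0 ≤ M ∧ IsType2With X M}.Nonempty := by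
    refine ⟨|M|, abs_nonneg _, fun m x => (hM m x).trans ?_⟩
    exact mul_le_mul_of_nonneg_right (le_abs_self _) (Real.sqrt_nonneg _)
  refine ⟨le_csInf hne fun b hb => hb.1, fun m x => ?_⟩
  rcases (Real.sqrt_nonneg (∑ i, ‖x i‖ ^ 2)).eq_or_lt with h0 | h0
  · have := hM m x
    rw [← h0] at this ⊢
    simpa using this
  · rw [← div_le_iff₀ h0]
    refine le_csInf hne fun b hb => ?_
    rw [div_le_iff₀ h0]
    exact hb.2 m x

lemma ri_alpha {L α c : ℝ} (hL0 : 0 ≤ L) (hL : 1 / 2 ≤ L ^ 2) (hc : c = 1 / 10000)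
    (hα : α = c * (Real.log (2 * L)) ^ (-(3 / 2) : ℝ)) : 0 ≤ α ∧ α ≤ 1 / 64 := by
  have hlog : (1 / 4 : ℝ) ≤ Real.log (2 * L) := by
    have h1 : Real.log 2 ≤ Real.log ((2 * L) ^ 2) :=
      Real.log_le_log (by norm_num) (by nlinarith)
    rw [Real.log_pow] at h1
    have := Real.log_two_gt_d9
    push_cast at h1
    linarith
  have h2 : (Real.log (2 * L)) ^ (-(3 / 2) : ℝ) ≤ (1 / 4 : ℝ) ^ (-(3 / 2) : ℝ) :=
    Real.rpow_le_rpow_of_nonpos (by norm_num) hlog (by norm_num)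
  have h3 : (1 / 4 : ℝ) ^ (-(3 / 2) : ℝ) ≤ (1 / 4 : ℝ) ^ (-2 : ℝ) :=
    Real.rpow_le_rpow_of_exponent_ge (by norm_num) (by norm_num) (by norm_num)
  have h4 : (1 / 4 : ℝ) ^ (-2 : ℝ) = 16 := by
    rw [Real.rpow_neg (by norm_num)]; norm_num
  have h5 : 0 ≤ (Real.log (2 * L)) ^ (-(3 / 2) : ℝ) := Real.rpow_nonneg (by linarith) _
  rw [hα, hc]
  constructor
  · positivity
  · linarith

theorem restricted_invertibility_type_two :
    ∃ c > (0 : ℝ), ∀ (n : ℕ) (X : Type) [inst1 : NormedAddCommGroup X]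
      [inst2 : NormedSpace ℝ X] [inst3 : CompleteSpace X],
      (∃ M : ℝ, IsType2With X M) →
      ∀ T : EuclideanSpace ℝ (Fin n) →L[ℝ] X,
      (n : ℝ) ≤ ellNormSq T →
      ∀ α : ℝ, α = c * (Real.log (2 * ‖T‖)) ^ (-(3 / 2) : ℝ) →
      ∃ s : Finset (Fin n), α ^ 2 * n / ‖T‖ ^ 2 ≤ s.card ∧
        ∀ x : EuclideanSpace ℝ (Fin n), (∀ i ∉ s, x i = 0) →
          α * (type2Const X)⁻¹ * ‖x‖ ≤ ‖T x‖ := by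
  refine ⟨1 / 10000, by norm_num, ?_⟩
  intro n X _ _ _ htype T hT α hα
  obtain ⟨hM0, hM⟩ := ri_type2Const htype
  set M := type2Const X with hMdef
  rcases Nat.eq_zero_or_pos n with hn | hn
  · subst hn
    refine ⟨∅, by simp, fun x _ => ?_⟩
    have : x = 0 := Subsingleton.elim _ _
    simp [this]
  have hn' : (0 : ℝ) < n := by exact_mod_cast hn
  have hL : 1 / 2 ≤ ‖T‖ ^ 2 := by
    have := ri_key T M hM0 hM (fun i => EuclideanSpace.single i (1 : ℝ)) (fun v => by
      rw [EuclideanSpace.real_norm_sq_eq]; simp [EuclideanSpace.inner_single_left])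
    have h2 : ∑ j : Fin n, min (4 * M ^ 2 * ‖T (EuclideanSpace.single j (1 : ℝ))‖ ^ 2)
        (2 * ‖T‖ ^ 2 * ‖(EuclideanSpace.single j (1 : ℝ) : EuclideanSpace ℝ (Fin n))‖ ^ 2) ≤
        ∑ j : Fin n, 2 * ‖T‖ ^ 2 := by
      refine Finset.sum_le_sum fun j _ => (min_le_right _ _).trans ?_
      simp
    have h3 := (hT.trans this).trans h2
    simp only [Finset.sum_const, Finset.card_univ, Fintype.card_fin, nsmul_eq_mul] at h3
    have h4 : (n : ℝ) * 1 ≤ n * (2 * ‖T‖ ^ 2) := by linarith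
    have := le_of_mul_le_mul_left h4 hn'
    linarith
  obtain ⟨hα0, hα1⟩ := ri_alpha (norm_nonneg T) hL rfl hα
  have hnorm : ∀ x : Fin n → ℝ, ‖(WithLp.toLp 2 x : EuclideanSpace ℝ (Fin n))‖ ^ 2 = x ⬝ᵥ x := by
    intro x
    rw [EuclideanSpace.real_norm_sq_eq]; simp [dotProduct, sq]
  obtain ⟨Z, hZ, hZt, hZφ⟩ := ri_dual hn
    (fun x => min (4 * M ^ 2 * ‖T (WithLp.toLp 2 x)‖ ^ 2)
      (2 * ‖T‖ ^ 2 * ‖(WithLp.toLp 2 x : EuclideanSpace ℝ (Fin n))‖ ^ 2))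
    (fun x => by positivity)
    (fun c x => by
      rw [WithLp.toLp_smul, map_smul, norm_smul, norm_smul, mul_min_of_nonneg _ _ (sq_nonneg c),
        Real.norm_eq_abs, mul_pow, mul_pow, sq_abs]
      congr 1 <;> ring)
    (fun l hl => by
      have := ri_key T M hM0 hM (fun j : Fin l.length => WithLp.toLp 2 (l[j])) (fun v => by
        have h1 := hl v.ofLp
        rw [← hnorm, ← Fin.sum_univ_fun_getElem] at h1
        refine h1.trans (le_of_eq ?_)
        refine Finset.sum_congr rfl fun j _ => ?_
        simp [PiLp.inner_apply, dotProduct, mul_comm])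
      refine (hT.trans this).trans (le_of_eq ?_)
      rw [← Fin.sum_univ_fun_getElem]
      rfl)
  obtain ⟨s, hs1, hs2⟩ := ri_select hn Z hZ ‖T‖ hL
    (fun v => by
      rw [← hnorm]; exact (hZφ v).trans (min_le_right _ _)) hZt
  refine ⟨s, ?_, ?_⟩
  · have h1 : α ^ 2 ≤ 1 / 256 := by nlinarith
    have h2 : 0 ≤ (n : ℝ) / ‖T‖ ^ 2 := by positivity
    rw [mul_div_assoc]
    nlinarith
  · intro x hx
    rcases hM0.eq_or_lt with h0 | h0
    · rw [← h0]; simp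
    have h1 := hs2 x.ofLp hx
    have h2 := (hZφ x.ofLp).trans (min_le_left _ _)
    rw [← hnorm] at h1
    have h3 := h1.trans h2
    have h4 : ‖x‖ ^ 2 ≤ (64 * M * ‖T x‖) ^ 2 := by
      have : (WithLp.toLp 2 x.ofLp : EuclideanSpace ℝ (Fin n)) = x := rfl
      rw [this] at h3
      nlinarith
    have h5 : ‖x‖ ≤ 64 * M * ‖T x‖ := abs_le_of_sq_le_sq' h4 (by positivity) |>.2
    calc α * M⁻¹ * ‖x‖ ≤ 1 / 64 * M⁻¹ * (64 * M * ‖T x‖) := by gcongr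
      _ = ‖T x‖ := by field_simp
end
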